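/- arXiv:1508.05567 — 2 statements merged into one kernel-verified Lean document; each statement's English description precedes it below -/
import Mathlib

section
/- Let (G = (V, E), 𝒞) be an instance of Star Strong Connectivity with |V| ≥ 2. Then there exists a perfect set Q ⊆ 𝒞 such that either (a) |Q| ≥ 4 and there is a cut internal to Q, or (b) there are two cuts S₁ ≠ S₂ that are both internal to Q and star-disjoint from each other. -/
def SReach {V : Type*} (E : Finset (V × V)) : V → V → Prop :=
  Relation.ReflTransGen (fun u v => (u, v) ∈ E)

def SConn {V : Type*} (E : Finset (V × V)) : Prop :=
  ∀ u v : V, SReach E u v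

def IsDigraph {V : Type*} (E : Finset (V × V)) : Prop :=
  ∀ a ∈ E, a.1 ≠ a.2

def IsStar {V : Type*} (F : Finset (V × V)) : Prop :=
  F.Nonempty ∧ (∀ a ∈ F, ∀ b ∈ F, a.1 = b.1) ∧ (∀ a ∈ F, a.1 ≠ a.2)

def cutStars {V : Type*} [DecidableEq V] (𝒞 : Finset (Finset (V × V))) (S : Finset V) :
    Finset (Finset (V × V)) :=
  𝒞.filter (fun F => (∃ a ∈ F, a.1 ∈ S) ∧ (∃ a ∈ F, a.2 ∉ S))

def srcSet {V : Type*} [DecidableEq V] (Q : Finset (Finset (V × V))) : Finset V :=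
  Q.biUnion (fun F => F.image Prod.fst)

def Quasiperfect {V : Type*} [DecidableEq V] (Q : Finset (Finset (V × V))) : Prop :=
  (∀ F ∈ Q, ∀ G ∈ Q, F ≠ G → ∀ a ∈ F, ∀ b ∈ G, a.1 ≠ b.1) ∧
  (∀ u ∈ srcSet Q, ∀ v ∈ srcSet Q,
    Relation.ReflTransGen
      (fun x y => x ∈ srcSet Q ∧ y ∈ srcSet Q ∧ (x, y) ∈ Q.biUnion id) u v)

def PerfectSet {V : Type*} [DecidableEq V] (Q : Finset (Finset (V × V))) : Prop :=
  Quasiperfect Q ∧ ∀ F ∈ Q, ∀ a ∈ F, a.2 ∈ srcSet Q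

def InternalCut {V : Type*} [Fintype V] [DecidableEq V]
    (𝒞 Q : Finset (Finset (V × V))) (S : Finset V) : Prop :=
  S.Nonempty ∧ S ≠ Finset.univ ∧
  ∀ F ∈ cutStars 𝒞 S, (∀ a ∈ F, a.1 ∈ srcSet Q) ∧ (∀ a ∈ F, a.2 ∈ srcSet Q)

/-- `Arc 𝒞 x y`: some star of `𝒞` contains the arc from `x` to `y`. -/
def Arc {V : Type*} (𝒞 : Finset (Finset (V × V))) (x y : V) : Prop :=
  ∃ F ∈ 𝒞, (x, y) ∈ F

/-- The conclusion of the main theorem for the collection `𝒞`. -/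
def HasGoodPerfectSet {V : Type*} [Fintype V] [DecidableEq V]
    (𝒞 : Finset (Finset (V × V))) : Prop :=
  ∃ Q ⊆ 𝒞, PerfectSet Q ∧
    ((4 ≤ Q.card ∧ ∃ S : Finset V, InternalCut 𝒞 Q S) ∨
     (∃ S₁ S₂ : Finset V, S₁ ≠ S₂ ∧ InternalCut 𝒞 Q S₁ ∧ InternalCut 𝒞 Q S₂ ∧
        cutStars 𝒞 S₁ ∩ cutStars 𝒞 S₂ = ∅))

/-- `ClosedUnder T U`: every star of `T` with source in `U` has all its sinks in `U`. -/
def ClosedUnder {V : Type*} (T : Finset (Finset (V × V))) (U : Finset V) : Prop :=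
  ∀ F ∈ T, ∀ x y, (x, y) ∈ F → x ∈ U → y ∈ U

theorem ClosedUnder.mono {V : Type*} {T T' : Finset (Finset (V × V))} {U : Finset V}
    (h : ClosedUnder T' U) (hT : T ⊆ T') : ClosedUnder T U :=
  fun F hF => h F (hT hF)

/-- `InTree 𝒞 r B T`: the stars of `T ⊆ 𝒞`, one for each vertex of `B` other than `r`, lead
every vertex of `B` to the root `r`. -/
inductive InTree {V : Type*} [DecidableEq V] (𝒞 : Finset (Finset (V × V))) (r : V) :
    Finset V → Finset (Finset (V × V)) → Prop
  | root : InTree 𝒞 r {r} ∅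
  | add {B : Finset V} {T : Finset (Finset (V × V))} {F : Finset (V × V)} {x y : V}
      (h : InTree 𝒞 r B T) (hx : x ∉ B) (hF : F ∈ 𝒞) (hxy : (x, y) ∈ F) (hy : y ∈ B) :
      InTree 𝒞 r (insert x B) (insert F T)

section StarConnectivity

variable {V : Type*} {𝒞 : Finset (Finset (V × V))}

theorem IsStar.source_eq {F : Finset (V × V)} (h : IsStar F) {x y x' y' : V}
    (h₁ : (x, y) ∈ F) (h₂ : (x', y') ∈ F) : x = x' :=
  h.2.1 _ h₁ _ h₂

theorem Arc.ne (hstar : ∀ F ∈ 𝒞, IsStar F) {x y : V} (h : Arc 𝒞 x y) : x ≠ y := by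
  obtain ⟨F, hF, hxy⟩ := h
  exact (hstar F hF).2.2 _ hxy

/-- A strongly connected collection has an arc leaving any nontrivial set of vertices. -/
theorem exists_arc_leaving (hconn : ∀ u v, Relation.ReflTransGen (Arc 𝒞) u v) {P : V → Prop}
    {x y : V} (hx : P x) (hy : ¬ P y) : ∃ s t, P s ∧ ¬ P t ∧ Arc 𝒞 s t := by
  by_contra! hcon
  have : ∀ z, Relation.ReflTransGen (Arc 𝒞) x z → P z := by
    intro z hz
    induction hz with
    | refl => exact hx
    | tail _ h ih =>
      by_contra hn
      exact hcon _ _ ih hn h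
  exact hy (this y (hconn x y))

variable [DecidableEq V]

theorem mem_srcSet {Q : Finset (Finset (V × V))} {x : V} :
    x ∈ srcSet Q ↔ ∃ F ∈ Q, ∃ y, (x, y) ∈ F := by
  simp [srcSet]

theorem card_srcSet_le (hstar : ∀ F ∈ 𝒞, IsStar F) {Q : Finset (Finset (V × V))}
    (hQ : Q ⊆ 𝒞) : (srcSet Q).card ≤ Q.card := by
  have := Finset.card_biUnion_le_card_mul Q (fun F => F.image Prod.fst) 1 ?_
  · simpa [srcSet] using this
  · intro F hF
    rw [Finset.card_le_one]
    intro a ha b hb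
    obtain ⟨p, hp, rfl⟩ := Finset.mem_image.1 ha
    obtain ⟨q, hq, rfl⟩ := Finset.mem_image.1 hb
    exact (hstar F (hQ hF)).2.1 p hp q hq

namespace InTree

variable {r : V} {B : Finset V} {T : Finset (Finset (V × V))}

theorem root_mem (h : InTree 𝒞 r B T) : r ∈ B := by
  induction h with
  | root => simp
  | add _ _ _ _ _ ih => exact Finset.mem_insert_of_mem ih

theorem subset (h : InTree 𝒞 r B T) : T ⊆ 𝒞 := by
  induction h with
  | root => simp
  | add _ _ hF _ _ ih => exact Finset.insert_subset hF ih

theorem source_mem (hstar : ∀ F ∈ 𝒞, IsStar F) (h : InTree 𝒞 r B T) :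
    ∀ F ∈ T, ∀ x y, (x, y) ∈ F → x ∈ B ∧ x ≠ r := by
  induction h with
  | root => simp
  | @add B T F x y h hx hF hxy hy ih =>
    intro G hG x' y' hxy'
    rcases Finset.mem_insert.1 hG with rfl | hG
    · obtain rfl := (hstar _ hF).source_eq hxy hxy'
      exact ⟨by simp, fun e => hx (e ▸ h.root_mem)⟩
    · exact ⟨Finset.mem_insert_of_mem (ih G hG _ _ hxy').1, (ih G hG _ _ hxy').2⟩

theorem eq_of_source (hstar : ∀ F ∈ 𝒞, IsStar F) (h : InTree 𝒞 r B T) :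
    ∀ F ∈ T, ∀ G ∈ T, ∀ x y z, (x, y) ∈ F → (x, z) ∈ G → F = G := by
  induction h with
  | root => simp
  | @add B T F x y h hx hF hxy hy ih =>
    intro G hG H hH x' y' z' h₁ h₂
    rcases Finset.mem_insert.1 hG with rfl | hG' <;> rcases Finset.mem_insert.1 hH with rfl | hH'
    · rfl
    · obtain rfl := (hstar _ hF).source_eq hxy h₁
      exact absurd (h.source_mem hstar _ hH' _ _ h₂).1 hx
    · obtain rfl := (hstar _ hF).source_eq hxy h₂
      exact absurd (h.source_mem hstar _ hG' _ _ h₁).1 hx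
    · exact ih G hG' H hH' x' y' z' h₁ h₂

theorem reaches (h : InTree 𝒞 r B T) :
    ∀ x ∈ B, Relation.ReflTransGen (Arc T) x r := by
  induction h with
  | root =>
    intro x hx
    rw [Finset.mem_singleton.1 hx]
  | @add B T F x y h hx hF hxy hy ih =>
    have hmono : ∀ z ∈ B, Relation.ReflTransGen (Arc (insert F T)) z r := fun z hz =>
      Relation.ReflTransGen.mono
        (fun s t ⟨G, hG, hst⟩ => ⟨G, Finset.mem_insert_of_mem hG, hst⟩) _ _ (ih z hz)
    intro z hz
    rcases Finset.mem_insert.1 hz with rfl | hz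
    · exact (hmono y hy).head ⟨F, Finset.mem_insert_self _ _, hxy⟩
    · exact hmono z hz

theorem exists_star (h : InTree 𝒞 r B T) :
    ∀ x ∈ B, x ≠ r → ∃ F ∈ T, ∃ y, (x, y) ∈ F := by
  induction h with
  | root => simp
  | @add B T F x y h hx hF hxy hy ih =>
    intro z hz hzr
    rcases Finset.mem_insert.1 hz with rfl | hz
    · exact ⟨F, Finset.mem_insert_self _ _, y, hxy⟩
    · obtain ⟨G, hG, w⟩ := ih z hz hzr
      exact ⟨G, Finset.mem_insert_of_mem hG, w⟩

/-- A tree can be extended along a path, avoiding `X`, that meets it only at its end `y`; then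
following the new stars from a new vertex leads to `y`. -/
theorem exists_extend_path (h : InTree 𝒞 r B T) {X : Set V} {x y : V} (hy : y ∈ B)
    (hBX : ∀ z ∈ B, z ≠ y → z ∈ X)
    (hp : Relation.ReflTransGen (fun s t => Arc 𝒞 s t ∧ s ∉ X) x y) :
    ∃ B' T', InTree 𝒞 r B' T' ∧ B ⊆ B' ∧ T ⊆ T' ∧ x ∈ B' ∧
      (∀ z ∈ B', z ∉ B → z ∉ X) ∧
      (∀ U, ClosedUnder T' U → ∀ z ∈ B', (z = y ∨ z ∉ B) → z ∈ U → y ∈ U) := by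
  induction hp using Relation.ReflTransGen.head_induction_on with
  | refl =>
    refine ⟨B, T, h, Finset.Subset.refl _, Finset.Subset.refl _, hy, ?_, ?_⟩
    · intro z hz hz'
      exact absurd hz hz'
    · rintro U - z hz (rfl | hz') hU
      · exact hU
      · exact absurd hz hz'
  | @head x x' hxx' hx'y ih =>
    obtain ⟨B', T', h', hB, hT, hx', hX, hU⟩ := ih
    by_cases hxB : x ∈ B'
    · exact ⟨B', T', h', hB, hT, hxB, hX, hU⟩
    obtain ⟨⟨F, hF, hxF⟩, hxX⟩ := hxx'
    refine ⟨insert x B', insert F T', h'.add hxB hF hxF hx',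
      hB.trans (Finset.subset_insert _ _), hT.trans (Finset.subset_insert _ _),
      Finset.mem_insert_self _ _, ?_, ?_⟩
    · intro z hz hzB
      rcases Finset.mem_insert.1 hz with rfl | hz
      · exact hxX
      · exact hX z hz hzB
    · intro U hcl z hz hzy hzU
      have hcl' := hcl.mono (Finset.subset_insert F T')
      rcases Finset.mem_insert.1 hz with rfl | hz
      · have hx'U : x' ∈ U := hcl F (Finset.mem_insert_self _ _) _ _ hxF hzU
        refine hU U hcl' x' hx' ?_ hx'U
        by_cases hx'B : x' ∈ B
        · left
          by_contra hne
          rcases Relation.ReflTransGen.cases_head hx'y with e | ⟨w, hw, -⟩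
          · exact hne e
          · exact hw.2 (hBX _ hx'B hne)
        · exact Or.inr hx'B
      · exact hU U hcl' z hz hzy hzU

/-- The special case of `exists_extend_path` where the tree is a single vertex. -/
theorem exists_of_path {X : Set V} {x y : V}
    (hp : Relation.ReflTransGen (fun s t => Arc 𝒞 s t ∧ s ∉ X) x y) :
    ∃ B T, InTree 𝒞 y B T ∧ x ∈ B ∧ ∀ z ∈ B, z ≠ y → z ∉ X := by
  obtain ⟨B, T, h, -, -, hx, hX, -⟩ := (InTree.root (𝒞 := 𝒞) (r := y)).exists_extend_path
    (Finset.mem_singleton_self y)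
    (fun z hz hzy => absurd (Finset.mem_singleton.1 hz) hzy) hp
  exact ⟨B, T, h, hx, fun z hz hzy => hX z hz (by simpa using hzy)⟩

theorem of_path {k : ℕ} {p : ℕ → V}
    (hinj : ∀ i ≤ k, ∀ j ≤ k, p i = p j → i = j) (harc : ∀ i < k, Arc 𝒞 (p i) (p (i + 1)))
    (j : ℕ) (hj : j ≤ k) : ∃ B T, InTree 𝒞 (p k) B T ∧
      (∀ x, x ∈ B ↔ ∃ i, j ≤ i ∧ i ≤ k ∧ p i = x) ∧
      ∀ U, ClosedUnder T U → ∀ i, j ≤ i → i < k → p i ∈ U → p (i + 1) ∈ U := by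
  induction hj using Nat.decreasingInduction with
  | self =>
    refine ⟨_, _, InTree.root, ?_, ?_⟩
    · intro x
      rw [Finset.mem_singleton]
      constructor
      · rintro rfl
        exact ⟨k, le_rfl, le_rfl, rfl⟩
      · rintro ⟨i, h₁, h₂, rfl⟩
        rw [le_antisymm h₂ h₁]
    · intro U _ i h₁ h₂
      omega
  | of_succ j hj ih =>
    obtain ⟨B, T, h, hB, hT⟩ := ih
    obtain ⟨F, hF, hjF⟩ := harc j hj
    refine ⟨_, _, h.add ?_ hF hjF ((hB _).2 ⟨j + 1, le_rfl, hj, rfl⟩), ?_, ?_⟩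
    · rw [hB]
      rintro ⟨i, h₁, h₂, e⟩
      have := hinj i h₂ j hj.le e
      omega
    · intro x
      rw [Finset.mem_insert, hB]
      constructor
      · rintro (rfl | ⟨i, h₁, h₂, e⟩)
        · exact ⟨j, le_rfl, hj.le, rfl⟩
        · exact ⟨i, by omega, h₂, e⟩
      · rintro ⟨i, h₁, h₂, e⟩
        rcases h₁.eq_or_lt with rfl | h₁
        · exact Or.inl e.symm
        · exact Or.inr ⟨i, h₁, h₂, e⟩
    · intro U hU i h₁ h₂ hi
      rcases h₁.eq_or_lt with rfl | h₁
      · exact hU F (Finset.mem_insert_self _ _) _ _ hjF hi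
      · exact hT U (hU.mono (Finset.subset_insert _ _)) i h₁ h₂ hi

theorem exists_extend_univ [Fintype V] (hconn : ∀ u v, Relation.ReflTransGen (Arc 𝒞) u v)
    (h : InTree 𝒞 r B T) : ∃ T', InTree 𝒞 r Finset.univ T' ∧ T ⊆ T' := by
  induction hn : (Bᶜ).card generalizing B T with
  | zero =>
    have : B = Finset.univ := by simpa using hn
    exact ⟨T, this ▸ h, Finset.Subset.refl _⟩
  | succ n ih =>
    obtain ⟨x, hx⟩ : (Bᶜ).Nonempty := Finset.card_pos.1 (by omega)
    obtain ⟨s, t, hs, ht, F, hF, hst⟩ := exists_arc_leaving hconn (P := fun z => z ∉ B)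
      (Finset.mem_compl.1 hx) (not_not.2 h.root_mem)
    obtain ⟨T', h', hT'⟩ := ih (h.add hs hF hst (not_not.1 ht)) (by
      rw [Finset.compl_insert, Finset.card_erase_of_mem (Finset.mem_compl.2 hs), hn]
      rfl)
    exact ⟨T', h', (Finset.subset_insert _ _).trans hT'⟩

/-- A tree together with a star at its root gives a perfect set containing the root, whose
source set is closed under these stars. -/
theorem exists_perfectSet [Fintype V] (hstar : ∀ F ∈ 𝒞, IsStar F)
    (hconn : ∀ u v, Relation.ReflTransGen (Arc 𝒞) u v)
    (h : InTree 𝒞 r B T) {F : Finset (V × V)} (hF : F ∈ 𝒞) {y : V} (hy : (r, y) ∈ F) :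
    ∃ Q ⊆ 𝒞, PerfectSet Q ∧ r ∈ srcSet Q ∧ ClosedUnder (insert F T) (srcSet Q) := by
  classical
  obtain ⟨T', h', hT⟩ := h.exists_extend_univ hconn
  set A := insert F T' with hA
  have hA𝒞 : A ⊆ 𝒞 := Finset.insert_subset hF h'.subset
  have hstarA : ∀ x, ∃ G ∈ A, ∃ z, (x, z) ∈ G := by
    intro x
    by_cases hx : x = r
    · exact ⟨F, Finset.mem_insert_self _ _, y, hx ▸ hy⟩
    · obtain ⟨G, hG, w⟩ := h'.exists_star x (Finset.mem_univ _) hx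
      exact ⟨G, Finset.mem_insert_of_mem hG, w⟩
  have hdist : ∀ G ∈ A, ∀ H ∈ A, ∀ x z w, (x, z) ∈ G → (x, w) ∈ H → G = H := by
    intro G hG H hH x z w hxz hxw
    rcases Finset.mem_insert.1 hG with rfl | hG' <;> rcases Finset.mem_insert.1 hH with rfl | hH'
    · rfl
    · obtain rfl := (hstar _ hF).source_eq hy hxz
      exact absurd rfl (h'.source_mem hstar _ hH' _ _ hxw).2
    · obtain rfl := (hstar _ hF).source_eq hy hxw
      exact absurd rfl (h'.source_mem hstar _ hG' _ _ hxz).2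
    · exact h'.eq_of_source hstar _ hG' _ hH' _ _ _ hxz hxw
  let R : V → Prop := fun x => Relation.ReflTransGen (Arc A) r x
  let Q := A.filter fun G => ∃ x z, (x, z) ∈ G ∧ R x
  have hsrc : ∀ x, x ∈ srcSet Q ↔ R x := by
    intro x
    rw [mem_srcSet]
    constructor
    · rintro ⟨G, hG, z, hxz⟩
      obtain ⟨hGA, x', z', hxz', hR⟩ := Finset.mem_filter.1 hG
      rwa [(hstar G (hA𝒞 hGA)).source_eq hxz hxz']
    · intro hx
      obtain ⟨G, hG, z, hxz⟩ := hstarA x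
      exact ⟨G, Finset.mem_filter.2 ⟨hG, x, z, hxz, hx⟩, z, hxz⟩
  have hclosed : ClosedUnder A (srcSet Q) := by
    intro G hG x z hxz hx
    rw [hsrc] at hx ⊢
    exact hx.tail ⟨G, hG, hxz⟩
  have hQA : Q ⊆ A := Finset.filter_subset _ _
  have hpath : ∀ u w, Relation.ReflTransGen (Arc A) u w → R u →
      Relation.ReflTransGen
        (fun x y => x ∈ srcSet Q ∧ y ∈ srcSet Q ∧ (x, y) ∈ Q.biUnion id) u w := by
    intro u w huw hu
    induction huw with
    | refl => exact .refl
    | @tail s t hus hst ih =>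
      refine ih.tail ?_
      have hs : R s := hu.trans hus
      obtain ⟨G, hG, hGst⟩ := hst
      refine ⟨(hsrc _).2 hs, (hsrc _).2 (hs.tail ⟨G, hG, hGst⟩), ?_⟩
      exact Finset.mem_biUnion.2 ⟨G, Finset.mem_filter.2 ⟨hG, s, t, hGst, hs⟩, hGst⟩
  refine ⟨Q, hQA.trans hA𝒞, ⟨⟨?_, ?_⟩, ?_⟩, (hsrc r).2 .refl,
    hclosed.mono (Finset.insert_subset_insert _ hT)⟩
  · rintro G hG H hH hne ⟨x, z⟩ ha ⟨x', w⟩ hb (rfl : x = x')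
    exact hne (hdist G (hQA hG) H (hQA hH) _ _ _ ha hb)
  · intro u hu w hw
    rw [hsrc] at hu hw
    have hur : Relation.ReflTransGen (Arc A) u r :=
      Relation.ReflTransGen.mono
        (fun s t ⟨G, hG, hst⟩ => ⟨G, Finset.mem_insert_of_mem hG, hst⟩)
        _ _ (h'.reaches u (Finset.mem_univ _))
    exact hpath u w (hur.trans hw) hu
  · rintro G hG ⟨x, z⟩ hxz
    exact hclosed G (hQA hG) x z hxz (mem_srcSet.2 ⟨G, hG, z, hxz⟩)

end InTree

variable [Fintype V]

theorem internalCut_of_forall (hstar : ∀ F ∈ 𝒞, IsStar F) {Q : Finset (Finset (V × V))}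
    {S : Finset V} {x y : V} (hx : x ∈ S) (hy : y ∉ S)
    (h : ∀ L ∈ 𝒞, ∀ s ∈ S, ∀ t ∉ S, (s, t) ∈ L →
      s ∈ srcSet Q ∧ ∀ z, (s, z) ∈ L → z ∈ srcSet Q) : InternalCut 𝒞 Q S := by
  refine ⟨⟨x, hx⟩, fun e => hy (e ▸ Finset.mem_univ y), ?_⟩
  intro F hF
  obtain ⟨hF𝒞, ⟨⟨s, t'⟩, ha, hs⟩, ⟨⟨s', t⟩, hb, ht⟩⟩ := Finset.mem_filter.1 hF
  obtain rfl := (hstar F hF𝒞).source_eq ha hb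
  obtain ⟨h₁, h₂⟩ := h F hF𝒞 s hs t ht hb
  constructor
  · rintro ⟨u, w⟩ hu
    rwa [← (hstar F hF𝒞).source_eq ha hu]
  · rintro ⟨u, w⟩ hu
    obtain rfl := (hstar F hF𝒞).source_eq ha hu
    exact h₂ w hu

theorem internalCut_singleton (hstar : ∀ F ∈ 𝒞, IsStar F) {Q : Finset (Finset (V × V))}
    {v p : V} (hp : p ≠ v) (hv : v ∈ srcSet Q) (hN : ∀ y, Arc 𝒞 v y → y ∈ srcSet Q) :
    InternalCut 𝒞 Q {v} := by
  refine internalCut_of_forall hstar (Finset.mem_singleton_self v)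
    (by simpa using hp) ?_
  intro L hL s hs t _ _
  obtain rfl := Finset.mem_singleton.1 hs
  exact ⟨hv, fun z hz => hN z ⟨L, hL, hz⟩⟩

/-- The singleton cut `{v}` and the cut given by `P` witness the second alternative. -/
theorem hasGoodPerfectSet_of_cut (hstar : ∀ F ∈ 𝒞, IsStar F)
    {Q : Finset (Finset (V × V))} (hQ : Q ⊆ 𝒞) (hperf : PerfectSet Q) {v : V}
    (hv : v ∈ srcSet Q) (hN : ∀ y, Arc 𝒞 v y → y ∈ srcSet Q) (P : V → Prop) {x y : V}
    (hx : P x) (hxv : x ≠ v) (hy : ¬ P y)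
    (h : ∀ L ∈ 𝒞, ∀ s t, P s → ¬ P t → (s, t) ∈ L →
      s ≠ v ∧ s ∈ srcSet Q ∧ ∀ z, (s, z) ∈ L → z ∈ srcSet Q) : HasGoodPerfectSet 𝒞 := by
  classical
  refine ⟨Q, hQ, hperf, Or.inr ⟨{v}, Finset.univ.filter P, ?_,
    internalCut_singleton hstar hxv hv hN,
    internalCut_of_forall hstar (x := x) (y := y) (by simpa using hx) (by simpa using hy) ?_, ?_⟩⟩
  · intro e
    have : x ∈ ({v} : Finset V) := by rw [e]; simpa using hx
    exact hxv (by simpa using this)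
  · intro L hL s hs t ht hst
    exact (h L hL s t (by simpa using hs) (by simpa using ht) hst).2
  · rw [Finset.eq_empty_iff_forall_notMem]
    intro F hF
    obtain ⟨h₁, h₂⟩ := Finset.mem_inter.1 hF
    obtain ⟨hF𝒞, ⟨⟨s, t'⟩, ha, hs⟩, ⟨⟨s', t⟩, hb, ht⟩⟩ := Finset.mem_filter.1 h₂
    obtain ⟨-, ⟨⟨u, w⟩, hc, hu⟩, -⟩ := Finset.mem_filter.1 h₁
    obtain rfl := (hstar F hF𝒞).source_eq ha hb
    obtain rfl := (hstar F hF𝒞).source_eq ha hc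
    exact (h F hF𝒞 s t (by simpa using hs) (by simpa using ht) hb).1 (by simpa using hu)

/-- Without a good perfect set, a perfect set to which `{v}` is internal has at most three
sources. -/
theorem mem_of_not_hasGoodPerfectSet (hstar : ∀ F ∈ 𝒞, IsStar F)
    (hno : ¬ HasGoodPerfectSet 𝒞) {Q : Finset (Finset (V × V))} (hQ : Q ⊆ 𝒞)
    (hperf : PerfectSet Q) {v : V} (hN : ∀ y, Arc 𝒞 v y → y ∈ srcSet Q) {a b : V}
    (hv : v ∈ srcSet Q) (ha : a ∈ srcSet Q) (hb : b ∈ srcSet Q)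
    (hva : v ≠ a) (hvb : v ≠ b) (hab : a ≠ b) {z : V} (hz : z ∈ srcSet Q) :
    z = v ∨ z = a ∨ z = b := by
  by_contra! hne
  obtain ⟨h₁, h₂, h₃⟩ := hne
  refine hno ⟨Q, hQ, hperf, Or.inl ⟨?_, {v}, internalCut_singleton hstar hva.symm hv hN⟩⟩
  refine le_trans ?_ (card_srcSet_le hstar hQ)
  have hcard : ({z, v, a, b} : Finset V).card = 4 := by
    rw [Finset.card_insert_of_notMem, Finset.card_insert_of_notMem,
      Finset.card_insert_of_notMem, Finset.card_singleton] <;> simp [*]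
  rw [← hcard]
  apply Finset.card_le_card
  intro w hw
  simp only [Finset.mem_insert, Finset.mem_singleton] at hw
  rcases hw with rfl | rfl | rfl | rfl <;> assumption

theorem hasGoodPerfectSet_of_unique_out (hstar : ∀ F ∈ 𝒞, IsStar F)
    (hconn : ∀ u v, Relation.ReflTransGen (Arc 𝒞) u v) {q p : V} (hqp : Arc 𝒞 q p)
    (hout : ∀ y, Arc 𝒞 q y → y = p) : HasGoodPerfectSet 𝒞 := by
  by_contra hno
  have hne : q ≠ p := hqp.ne hstar
  obtain ⟨Fq, hFq, hqFq⟩ := hqp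
  have hN : ∀ {Q : Finset (Finset (V × V))}, p ∈ srcSet Q →
      ∀ y, Arc 𝒞 q y → y ∈ srcSet Q := fun hp y hy => hout y hy ▸ hp
  by_cases hA : ∃ u, u ≠ p ∧ Arc 𝒞 u q
  · obtain ⟨u, hup, huq⟩ := hA
    have huq' := huq.ne hstar
    obtain ⟨H, hH, huH⟩ := huq
    have key : ∀ L ∈ 𝒞, (p, u) ∈ L → ∃ Q ⊆ 𝒞, PerfectSet Q ∧ p ∈ srcSet Q ∧ q ∈ srcSet Q ∧
        u ∈ srcSet Q ∧ ∀ z, (p, z) ∈ L → z ∈ srcSet Q := by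
      intro L hL hpu
      have t₁ := (InTree.root (𝒞 := 𝒞) (r := p)).add (x := q) (by simpa using hne) hFq hqFq
        (by simp)
      have t₂ := t₁.add (x := u) (by simp [huq', hup]) hH huH (by simp)
      obtain ⟨Q, hQ, hperf, hp, hcl⟩ := t₂.exists_perfectSet hstar hconn hL hpu
      have hu : u ∈ srcSet Q := hcl L (by simp) _ _ hpu hp
      exact ⟨Q, hQ, hperf, hp, hcl H (by simp) _ _ huH hu, hu,
        fun z hz => hcl L (by simp) _ _ hz hp⟩
    let C : V → Prop := fun x =>
      Relation.ReflTransGen (fun s t => Arc 𝒞 s t ∧ t ≠ u) p x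
    have hCu : ¬ C u := by
      intro h
      rcases Relation.ReflTransGen.cases_tail h with e | ⟨w, -, hw⟩
      · exact hup e
      · exact hw.2 rfl
    have hCq : ∀ s, C s → s = q ∨ Relation.ReflTransGen
        (fun s t => Arc 𝒞 s t ∧ s ∉ ({q, u} : Set V)) p s := by
      intro s hs
      induction hs with
      | refl => exact Or.inr .refl
      | @tail x t hx ht ih =>
        by_cases htq : t = q
        · exact Or.inl htq
        right
        by_cases hxq : x = q
        · have := hout t (hxq ▸ ht.1)
          rw [this]
        · refine (ih.resolve_left hxq).tail ⟨ht.1, ?_⟩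
          rintro (e | e)
          · exact hxq e
          · have e : x = u := e
            exact hCu (e ▸ hx)
    have hleave : ∀ L ∈ 𝒞, ∀ s t, C s → ¬ C t → (s, t) ∈ L → s = p ∧ t = u := by
      intro L hL s t hs ht hst
      have htu : t = u := by
        by_contra h
        exact ht (hs.tail ⟨⟨L, hL, hst⟩, h⟩)
      refine ⟨?_, htu⟩
      subst htu
      by_contra hsp
      have hsq : s ≠ q := by
        rintro rfl
        exact hup (hout t ⟨L, hL, hst⟩)
      have hst' : s ≠ t := Arc.ne hstar ⟨L, hL, hst⟩
      obtain ⟨B, T, t₀, hpB, hBX⟩ := InTree.exists_of_path ((hCq s hs).resolve_left hsq)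
      have hqB : q ∉ B := fun h => hBX q h hsq.symm (by simp)
      have htB : t ∉ B := fun h => hBX t h hst'.symm (by simp)
      have t₁ := t₀.add hqB hFq hqFq hpB
      have t₂ := t₁.add (x := t) (by simp [huq', htB]) hH huH (by simp)
      obtain ⟨Q, hQ, hperf, hsQ, hcl⟩ := t₂.exists_perfectSet hstar hconn hL hst
      have h₁ : t ∈ srcSet Q := hcl L (by simp) _ _ hst hsQ
      have h₂ : q ∈ srcSet Q := hcl H (by simp) _ _ huH h₁
      have h₃ : p ∈ srcSet Q := hcl Fq (by simp) _ _ hqFq h₂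
      rcases mem_of_not_hasGoodPerfectSet hstar hno hQ hperf (hN h₃) h₂ h₃ h₁ hne huq'.symm
        hup.symm hsQ with e | e | e
      · exact hsq e
      · exact hsp e
      · exact hst' e
    obtain ⟨s, t, hs, ht, L₀, hL₀, hst⟩ := exists_arc_leaving hconn (P := C)
      (x := p) (y := u) .refl hCu
    obtain ⟨rfl, rfl⟩ := hleave L₀ hL₀ s t hs ht hst
    obtain ⟨Q, hQ, hperf, hp, hq, hu, -⟩ := key L₀ hL₀ hst
    refine hno (hasGoodPerfectSet_of_cut hstar hQ hperf hq (hN hp) C (x := s) (y := t)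
      .refl hne.symm hCu ?_)
    intro L hL s' t' hs' ht' hst'
    obtain ⟨rfl, rfl⟩ := hleave L hL s' t' hs' ht' hst'
    refine ⟨hne.symm, hp, fun z hz => ?_⟩
    obtain ⟨Q', hQ', hperf', hp', hq', hu', hz'⟩ := key L hL hst'
    rcases mem_of_not_hasGoodPerfectSet hstar hno hQ' hperf' (hN hp') hq' hp' hu' hne huq'.symm
        hup.symm (hz' z hz) with rfl | rfl | rfl <;> assumption
  push Not at hA
  by_cases hB : ∃ H ∈ 𝒞, (p, q) ∈ H ∧ ∃ z, (p, z) ∈ H ∧ z ≠ q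
  · obtain ⟨H, hH, hpq, z, hpz, hzq⟩ := hB
    have hpz' : p ≠ z := Arc.ne hstar ⟨H, hH, hpz⟩
    let C : V → Prop := fun x =>
      Relation.ReflTransGen (fun s t => Arc 𝒞 s t ∧ s ∉ ({z} : Set V)) x p
    have hCz : ¬ C z := by
      intro h
      rcases Relation.ReflTransGen.cases_head h with e | ⟨w, hw, -⟩
      · exact hpz' e.symm
      · exact hw.2 rfl
    have key : ∀ L ∈ 𝒞, ∀ s t, ¬ C s → C t → (s, t) ∈ L → s = z ∧
        ∃ Q ⊆ 𝒞, PerfectSet Q ∧ p ∈ srcSet Q ∧ q ∈ srcSet Q ∧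
        z ∈ srcSet Q ∧ ∀ w, (z, w) ∈ L → w ∈ srcSet Q := by
      intro L hL s t hs ht hst
      have hsz : s = z := by
        by_contra h
        exact hs (ht.head ⟨⟨L, hL, hst⟩, h⟩)
      subst hsz
      refine ⟨rfl, ?_⟩
      obtain ⟨B, T, t₀, htB, hBX⟩ := InTree.exists_of_path ht
      have hsB : s ∉ B := fun h => hBX s h hpz'.symm rfl
      have t₁ := t₀.add hsB hL hst htB
      obtain ⟨Q, hQ, hperf, hp, hcl⟩ := t₁.exists_perfectSet hstar hconn hH hpq
      have hsQ : s ∈ srcSet Q := hcl H (by simp) _ _ hpz hp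
      exact ⟨Q, hQ, hperf, hp, hcl H (by simp) _ _ hpq hp, hsQ,
        fun w hw => hcl L (by simp) _ _ hw hsQ⟩
    obtain ⟨s, t, hs, ht, L₀, hL₀, hst⟩ := exists_arc_leaving hconn (P := fun x => ¬ C x)
      (x := z) (y := p) hCz (not_not.2 .refl)
    obtain ⟨-, Q, hQ, hperf, hp, hq, hz, -⟩ := key L₀ hL₀ s t hs (not_not.1 ht) hst
    refine hno (hasGoodPerfectSet_of_cut hstar hQ hperf hq (hN hp) (fun x => ¬ C x)
      (x := z) (y := p) hCz hzq (not_not.2 .refl) ?_)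
    intro L hL s' t' hs' ht' hst'
    obtain ⟨rfl, Q', hQ', hperf', hp', hq', hz', hL'⟩ := key L hL s' t' hs' (not_not.1 ht') hst'
    refine ⟨hzq, hz, fun w hw => ?_⟩
    rcases mem_of_not_hasGoodPerfectSet hstar hno hQ' hperf' (hN hp') hq' hp' hz' hne
      hzq.symm hpz' (hL' w hw) with rfl | rfl | rfl <;> assumption
  · push Not at hB
    obtain ⟨s, t, hs, ht, H, hH, hst⟩ := exists_arc_leaving hconn (P := fun x => x ≠ q)
      (x := p) (y := q) hne.symm (not_not.2 rfl)
    obtain rfl : t = q := not_not.1 ht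
    obtain rfl : s = p := by
      by_contra h
      exact hA s h ⟨H, hH, hst⟩
    have t₁ := (InTree.root (𝒞 := 𝒞) (r := s)).add (x := t) (by simpa using hne) hFq hqFq
        (by simp)
    obtain ⟨Q, hQ, hperf, hp, hcl⟩ := t₁.exists_perfectSet hstar hconn hH hst
    have hq : t ∈ srcSet Q := hcl H (by simp) _ _ hst hp
    refine hno (hasGoodPerfectSet_of_cut hstar hQ hperf hq (hN hp) (fun x => x ≠ t)
      (x := s) (y := t) hne.symm hne.symm (not_not.2 rfl) ?_)
    intro L hL s' t' hs' ht' hst'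
    obtain rfl : t' = t := not_not.1 ht'
    obtain rfl : s' = s := by
      by_contra h
      exact hA s' h ⟨L, hL, hst'⟩
    exact ⟨hne.symm, hp, fun z hz => hB L hL hst' z hz ▸ hq⟩

theorem hasGoodPerfectSet_of_triangle (hstar : ∀ F ∈ 𝒞, IsStar F)
    (hconn : ∀ u v, Relation.ReflTransGen (Arc 𝒞) u v) {v a b : V}
    (hout : ∀ y, Arc 𝒞 v y → y = a ∨ y = b) (hva : Arc 𝒞 v a) (hvb : Arc 𝒞 v b)
    (hab : Arc 𝒞 a b) (hbv : Arc 𝒞 b v) : HasGoodPerfectSet 𝒞 := by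
  by_contra hno
  have nva := hva.ne hstar
  have nvb := hvb.ne hstar
  have nab := hab.ne hstar
  obtain ⟨Fva, hFva, eva⟩ := hva
  obtain ⟨Fvb, hFvb, evb⟩ := hvb
  obtain ⟨Fab, hFab, eab⟩ := hab
  obtain ⟨Fbv, hFbv, ebv⟩ := hbv
  have hN : ∀ {Q : Finset (Finset (V × V))}, a ∈ srcSet Q → b ∈ srcSet Q →
      ∀ y, Arc 𝒞 v y → y ∈ srcSet Q := by
    intro Q ha hb y hy
    rcases hout y hy with rfl | rfl <;> assumption
  have small : ∀ {Q : Finset (Finset (V × V))}, Q ⊆ 𝒞 → PerfectSet Q → v ∈ srcSet Q →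
      a ∈ srcSet Q → b ∈ srcSet Q → ∀ {z}, z ∈ srcSet Q → z = v ∨ z = a ∨ z = b :=
    fun hQ hperf hv ha hb _ hz =>
      mem_of_not_hasGoodPerfectSet hstar hno hQ hperf (hN ha hb) hv ha hb nva nvb nab hz
  -- The perfect set on the triangle itself.
  have star_ab : ∀ L ∈ 𝒞, (a, b) ∈ L → ∃ Q ⊆ 𝒞, PerfectSet Q ∧ v ∈ srcSet Q ∧
      a ∈ srcSet Q ∧ b ∈ srcSet Q ∧ ∀ z, (a, z) ∈ L → z ∈ srcSet Q := by
    intro L hL haL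
    have t₁ := (InTree.root (𝒞 := 𝒞) (r := v)).add (x := b) (by simpa using nvb.symm) hFbv ebv
      (by simp)
    have t₂ := t₁.add (x := a) (by simp [nab, nva.symm]) hL haL (by simp)
    obtain ⟨Q, hQ, hperf, hv, hcl⟩ := t₂.exists_perfectSet hstar hconn hFva eva
    have ha : a ∈ srcSet Q := hcl Fva (by simp) _ _ eva hv
    exact ⟨Q, hQ, hperf, hv, ha, hcl L (by simp) _ _ haL ha,
      fun z hz => hcl L (by simp) _ _ hz ha⟩
  let Cv : V → Prop := fun x =>
    Relation.ReflTransGen (fun s t => Arc 𝒞 s t ∧ s ∉ ({a, b, v} : Set V)) x v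
  have star_b : ∀ L ∈ 𝒞, ∀ d, (b, d) ∈ L → Cv d → ∀ z, (b, z) ∈ L → z = v ∨ z = a ∨ z = b := by
    intro L hL d hd hCd z hz
    obtain ⟨B, T, t₀, hdB, hBX⟩ := InTree.exists_of_path hCd
    have hbB : b ∉ B := fun h => hBX b h nvb.symm (by simp)
    have haB : a ∉ B := fun h => hBX a h nva.symm (by simp)
    have t₁ := t₀.add hbB hL hd hdB
    have t₂ := t₁.add (x := a) (by simp [nab, haB]) hFab eab (by simp)
    obtain ⟨Q, hQ, hperf, hv, hcl⟩ := t₂.exists_perfectSet hstar hconn hFva eva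
    have ha : a ∈ srcSet Q := hcl Fva (by simp) _ _ eva hv
    have hb : b ∈ srcSet Q := hcl Fab (by simp) _ _ eab ha
    exact small hQ hperf hv ha hb (hcl L (by simp) _ _ hz hb)
  obtain ⟨Q₀, hQ₀, hperf₀, hv₀, ha₀, hb₀, -⟩ := star_ab Fab hFab eab
  have mem₀ : ∀ z, z = v ∨ z = a ∨ z = b → z ∈ srcSet Q₀ := by
    rintro z (rfl | rfl | rfl) <;> assumption
  let U : V → Prop := fun x =>
    Relation.ReflTransGen (fun s t => Arc 𝒞 s t ∧ s ∉ ({a, b, v} : Set V)) x a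
  have hU : ∀ x, U x → x ≠ b ∧ x ≠ v := by
    intro x hx
    rcases Relation.ReflTransGen.cases_head hx with rfl | ⟨w, hw, -⟩
    · exact ⟨nab, nva.symm⟩
    · have := hw.2
      simp only [Set.mem_insert_iff, Set.mem_singleton_iff, not_or] at this
      exact this.2
  have free : ∀ x, x ≠ a → x ≠ b → x ≠ v → x ∉ ({a, b, v} : Set V) := by
    intro x h₁ h₂ h₃
    simp [h₁, h₂, h₃]
  by_cases hd : ∃ d, U d ∧ Arc 𝒞 b d
  · obtain ⟨d, hdU, M, hM, hbd⟩ := hd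
    let C : V → Prop := fun x =>
      Relation.ReflTransGen (fun s t => Arc 𝒞 s t ∧ s ∉ ({b, v} : Set V) ∧ t ∉ ({b, v} : Set V)) a x
    have hC : ∀ x, C x → x ∉ ({b, v} : Set V) := by
      intro x hx
      rcases Relation.ReflTransGen.cases_tail hx with rfl | ⟨w, -, hw⟩
      · simp [nab, nva.symm]
      · exact hw.2.2
    have hCpath : ∀ s, C s →
        Relation.ReflTransGen (fun s t => Arc 𝒞 s t ∧ s ∉ ({b, v} : Set V)) a s :=
      fun s hs => Relation.ReflTransGen.mono (fun _ _ h => ⟨h.1, h.2.1⟩) _ _ hs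
    -- Stars entering `b` from `C` all start at `a`.
    have into_b : ∀ L ∈ 𝒞, ∀ s, C s → (s, b) ∈ L →
        s = a ∧ ∀ z, (s, z) ∈ L → z = v ∨ z = a ∨ z = b := by
      intro L hL s hs hsb
      have hsX := hC s hs
      simp only [Set.mem_insert_iff, Set.mem_singleton_iff, not_or] at hsX
      obtain ⟨B, T, t₀, haB, hBX⟩ := InTree.exists_of_path (hCpath s hs)
      have hvB : v ∉ B := fun h => hBX v h (Ne.symm hsX.2) (by simp)
      have hbB : b ∉ B := fun h => hBX b h (Ne.symm hsX.1) (by simp)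
      have t₁ := t₀.add hvB hFva eva haB
      have t₂ := t₁.add (x := b) (by simp [nvb.symm, hbB]) hFbv ebv (by simp)
      obtain ⟨Q, hQ, hperf, hsQ, hcl⟩ := t₂.exists_perfectSet hstar hconn hL hsb
      have hb : b ∈ srcSet Q := hcl L (by simp) _ _ hsb hsQ
      have hv : v ∈ srcSet Q := hcl Fbv (by simp) _ _ ebv hb
      have ha : a ∈ srcSet Q := hcl Fva (by simp) _ _ eva hv
      refine ⟨?_, fun z hz => small hQ hperf hv ha hb (hcl L (by simp) _ _ hz hsQ)⟩
      rcases small hQ hperf hv ha hb hsQ with e | e | e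
      · exact absurd e hsX.2
      · exact e
      · exact absurd e hsX.1
    have into_v : ∀ L ∈ 𝒞, ∀ s, C s → (s, v) ∈ L →
        s = a ∧ ∀ z, (s, z) ∈ L → z = v ∨ z = a ∨ z = b := by
      intro L hL s hs hsv
      have hsX := hC s hs
      simp only [Set.mem_insert_iff, Set.mem_singleton_iff, not_or] at hsX
      by_cases hda : d = a
      · subst hda
        obtain ⟨B, T, t₀, haB, hBX⟩ := InTree.exists_of_path (hCpath s hs)
        have hvB : v ∉ B := fun h => hBX v h (Ne.symm hsX.2) (by simp)
        have hbB : b ∉ B := fun h => hBX b h (Ne.symm hsX.1) (by simp)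
        have t₁ := t₀.add hbB hM hbd haB
        have t₂ := t₁.add (x := v) (by simp [nvb, hvB]) hFvb evb (by simp)
        obtain ⟨Q, hQ, hperf, hsQ, hcl⟩ := t₂.exists_perfectSet hstar hconn hL hsv
        have hv : v ∈ srcSet Q := hcl L (by simp) _ _ hsv hsQ
        have hb : b ∈ srcSet Q := hcl Fvb (by simp) _ _ evb hv
        have ha : d ∈ srcSet Q := hcl M (by simp) _ _ hbd hb
        refine ⟨?_, fun z hz => small hQ hperf hv ha hb (hcl L (by simp) _ _ hz hsQ)⟩
        rcases small hQ hperf hv ha hb hsQ with e | e | e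
        · exact absurd e hsX.2
        · exact e
        · exact absurd e hsX.1
      exfalso
      obtain ⟨hdb, hdv⟩ := hU d hdU
      have hdC : ¬ Cv d := by
        intro h
        rcases star_b M hM d hbd h d hbd with e | e | e
        · exact hdv e
        · exact hda e
        · exact hdb e
      obtain ⟨x₁, hx₁, L', hL', hax₁⟩ : ∃ x₁, Cv x₁ ∧ Arc 𝒞 a x₁ := by
        by_contra! hcon
        have step : ∀ x t, ¬ Cv x → x ≠ b → x ≠ v → Arc 𝒞 x t → ¬ Cv t := by
          intro x t hx hxb hxv hxt ht
          by_cases hxa : x = a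
          · exact hcon t ht (hxa ▸ hxt)
          · exact hx (ht.head ⟨hxt, free x hxa hxb hxv⟩)
        have haC : ¬ Cv a := by
          intro h
          rcases Relation.ReflTransGen.cases_head h with e | ⟨w, hw, -⟩
          · exact nva e.symm
          · exact hw.2 (by simp)
        have hsC : ¬ Cv s := by
          clear hsv hsX
          induction hs with
          | refl => exact haC
          | tail _ h ih =>
            have := h.2.1
            simp only [Set.mem_insert_iff, Set.mem_singleton_iff, not_or] at this
            exact step _ _ ih this.1 this.2 h.1
        exact step s v hsC hsX.1 hsX.2 ⟨L, hL, hsv⟩ .refl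
      have hdpath : Relation.ReflTransGen
          (fun s t => Arc 𝒞 s t ∧ s ∉ ({x | x = b ∨ x = v ∨ Cv x} : Set V)) d a := by
        clear hbd hdb hdv hda
        induction hdU using Relation.ReflTransGen.head_induction_on with
        | refl => exact .refl
        | @head x t hxt _ ih =>
          have hxX := hxt.2
          simp only [Set.mem_insert_iff, Set.mem_singleton_iff, not_or] at hxX
          refine (ih fun ht => hdC (ht.head hxt)).head ⟨hxt.1, ?_⟩
          rintro (e | e | e)
          · exact hxX.2.1 e
          · exact hxX.2.2 e
          · exact hdC e
      obtain ⟨B, T, t₀, hdB, hBX⟩ := InTree.exists_of_path hdpath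
      have hbB : b ∉ B := fun h => hBX b h nab.symm (Or.inl rfl)
      have hvB : v ∉ B := fun h => hBX v h nva (Or.inr (Or.inl rfl))
      have t₁ := t₀.add hbB hM hbd hdB
      have t₂ := t₁.add (x := v) (by simp [nvb, hvB]) hFvb evb (by simp)
      have hx₁path : Relation.ReflTransGen
          (fun s t => Arc 𝒞 s t ∧ s ∉ ({x | x = a ∨ x = b ∨ ¬ Cv x} : Set V)) x₁ v := by
        clear hax₁
        induction hx₁ using Relation.ReflTransGen.head_induction_on with
        | refl => exact .refl
        | @head x t hxt ht ih =>
          have hxX := hxt.2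
          simp only [Set.mem_insert_iff, Set.mem_singleton_iff, not_or] at hxX
          refine ih.head ⟨hxt.1, ?_⟩
          rintro (e | e | e)
          · exact hxX.1 e
          · exact hxX.2.1 e
          · exact e (Relation.ReflTransGen.head hxt ht)
      have hx₁a : x₁ ≠ a := Ne.symm (Arc.ne hstar ⟨L', hL', hax₁⟩)
      have hx₁b : x₁ = v ∨ x₁ ≠ b := by
        rcases Relation.ReflTransGen.cases_head hx₁ with e | ⟨w, hw, -⟩
        · exact Or.inl e
        · exact Or.inr fun e => hw.2 (by simp [e])
      obtain ⟨B', T', t₃, hBB', hTT', hx₁B', -, hthrough⟩ := t₂.exists_extend_path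
        (Finset.mem_insert_self v _) (X := {x | x = a ∨ x = b ∨ ¬ Cv x}) (by
          intro z hz hzv
          rcases Finset.mem_insert.1 hz with e | hz
          · exact absurd e hzv
          rcases Finset.mem_insert.1 hz with e | hz
          · exact Or.inr (Or.inl e)
          by_cases hza : z = a
          · exact Or.inl hza
          · exact Or.inr (Or.inr fun h => hBX z hz hza (Or.inr (Or.inr h)))) hx₁path
      obtain ⟨Q, hQ, hperf, ha, hcl⟩ := t₃.exists_perfectSet hstar hconn hL' hax₁
      have hx₁Q : x₁ ∈ srcSet Q := hcl L' (by simp) _ _ hax₁ ha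
      have hv : v ∈ srcSet Q := by
        refine hthrough _ (hcl.mono (Finset.subset_insert _ _)) x₁ hx₁B' ?_ hx₁Q
        rcases hx₁b with e | hx₁b
        · exact Or.inl e
        by_cases hx₁v : x₁ = v
        · exact Or.inl hx₁v
        right
        intro h
        simp only [Finset.mem_insert, hx₁v, hx₁b, false_or] at h
        exact hBX x₁ h hx₁a (Or.inr (Or.inr hx₁))
      have hcl₂ := hcl.mono (hTT'.trans (Finset.subset_insert _ _))
      have hb : b ∈ srcSet Q := hcl₂ Fvb (by simp) _ _ evb hv
      have hdQ : d ∈ srcSet Q := hcl₂ M (by simp) _ _ hbd hb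
      rcases small hQ hperf hv ha hb hdQ with e | e | e
      · exact hdv e
      · exact hda e
      · exact hdb e
    refine hno (hasGoodPerfectSet_of_cut hstar hQ₀ hperf₀ hv₀ (hN ha₀ hb₀) C (x := a) (y := v)
      .refl nva.symm (fun h => hC v h (by simp)) ?_)
    intro L hL s t hs ht hst
    have : s = a ∧ ∀ z, (s, z) ∈ L → z = v ∨ z = a ∨ z = b := by
      by_cases htb : t = b
      · exact into_b L hL s hs (htb ▸ hst)
      by_cases htv : t = v
      · exact into_v L hL s hs (htv ▸ hst)
      exact absurd (hs.tail ⟨⟨L, hL, hst⟩, hC s hs, by simp [htb, htv]⟩) ht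
    obtain ⟨rfl, hz⟩ := this
    exact ⟨nva.symm, ha₀, fun z hzL => mem₀ z (hz z hzL)⟩
  · push Not at hd
    let D : V → Prop := fun x =>
      Relation.ReflTransGen (fun s t => Arc 𝒞 s t ∧ t ≠ v) b x
    have hDv : ∀ x, D x → x ≠ v := by
      intro x hx
      rcases Relation.ReflTransGen.cases_tail hx with rfl | ⟨w, -, hw⟩
      · exact nvb.symm
      · exact hw.2
    have hDU : ∀ x, D x → ¬ U x := by
      intro x hx
      induction hx with
      | refl => exact fun h => (hU b h).1 rfl
      | @tail y t hy hyt ih =>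
        intro ht
        by_cases hyb : y = b
        · exact hd t ht (hyb ▸ hyt.1)
        by_cases hya : y = a
        · exact ih (hya ▸ .refl)
        exact ih (Relation.ReflTransGen.head ⟨hyt.1, free y hya hyb (hDv y hy)⟩ ht)
    have hDa : ∀ x, D x → x ≠ a := by
      rintro x hx rfl
      exact hDU x hx .refl
    have hDpath : ∀ x, D x →
        Relation.ReflTransGen (fun s t => Arc 𝒞 s t ∧ s ∉ ({a, v} : Set V)) b x := by
      intro x hx
      induction hx with
      | refl => exact .refl
      | @tail y t hy hyt ih =>
        exact ih.tail ⟨hyt.1, by simp [hDa y hy, hDv y hy]⟩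
    refine hno (hasGoodPerfectSet_of_cut hstar hQ₀ hperf₀ hv₀ (hN ha₀ hb₀) D (x := b) (y := v)
      .refl nvb.symm (fun h => hDv v h rfl) ?_)
    intro L hL s t hs ht hst
    obtain rfl : t = v := by
      by_contra h
      exact ht (hs.tail ⟨⟨L, hL, hst⟩, h⟩)
    by_cases hsb : s = b
    · subst hsb
      exact ⟨nvb.symm, hb₀, fun z hz => mem₀ z (star_b L hL t hst .refl z hz)⟩
    exfalso
    obtain ⟨B, T, t₀, hbB, hBX⟩ := InTree.exists_of_path (hDpath s hs)
    have haB : a ∉ B := fun h => hBX a h (hDa s hs).symm (by simp)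
    have htB : t ∉ B := fun h => hBX t h (hDv s hs).symm (by simp)
    have t₁ := t₀.add haB hFab eab hbB
    have t₂ := t₁.add (x := t) (by simp [nva, htB]) hFva eva (by simp)
    obtain ⟨Q, hQ, hperf, hsQ, hcl⟩ := t₂.exists_perfectSet hstar hconn hL hst
    have hv : t ∈ srcSet Q := hcl L (by simp) _ _ hst hsQ
    have ha : a ∈ srcSet Q := hcl Fva (by simp) _ _ eva hv
    have hb : b ∈ srcSet Q := hcl Fab (by simp) _ _ eab ha
    rcases small hQ hperf hv ha hb hsQ with e | e | e
    · exact hDv s hs e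
    · exact hDa s hs e
    · exact hsb e

/-- There is a path that cannot be extended at its end. -/
theorem exists_maximal_path [Nonempty V] : ∃ (k : ℕ) (p : ℕ → V),
    (∀ i ≤ k, ∀ j ≤ k, p i = p j → i = j) ∧ (∀ i < k, Arc 𝒞 (p i) (p (i + 1))) ∧
    ∀ y, Arc 𝒞 (p k) y → ∃ i ≤ k, p i = y := by
  classical
  let IsPath : ℕ → Prop := fun k => ∃ p : ℕ → V,
    (∀ i ≤ k, ∀ j ≤ k, p i = p j → i = j) ∧ ∀ i < k, Arc 𝒞 (p i) (p (i + 1))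
  have hbound : ∀ k, IsPath k → k ≤ Fintype.card V := by
    rintro k ⟨p, hinj, -⟩
    have := Finset.card_le_card_of_injOn (s := Finset.range (k + 1)) (t := Finset.univ) p
      (fun _ _ => Finset.mem_univ _) (fun i hi j hj h => hinj i (by simp at hi; omega) j
        (by simp at hj; omega) h)
    simp only [Finset.card_range, Finset.card_univ] at this
    omega
  have h0 : IsPath 0 := ⟨fun _ => Classical.arbitrary V, by
    intro i hi j hj _
    omega, by simp⟩
  have hk : IsPath (Nat.findGreatest IsPath (Fintype.card V)) :=
    Nat.findGreatest_spec (Nat.zero_le _) h0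
  set k := Nat.findGreatest IsPath (Fintype.card V) with hkdef
  obtain ⟨p, hinj, harc⟩ := hk
  refine ⟨k, p, hinj, harc, ?_⟩
  intro y hy
  by_contra! hcon
  have hnext : IsPath (k + 1) := by
    refine ⟨fun i => if i ≤ k then p i else y, ?_, ?_⟩
    · intro i hi j hj h
      by_cases hik : i ≤ k <;> by_cases hjk : j ≤ k <;> simp only [hik, hjk, if_true, if_false] at h
      · exact hinj i hik j hjk h
      · exact absurd h (hcon i hik)
      · exact absurd h.symm (hcon j hjk)
      · omega
    · intro i hi
      by_cases hik : i < k
      · simp only [hik.le, Nat.succ_le_of_lt hik, if_true]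
        exact harc i hik
      · obtain rfl : i = k := by omega
        simpa using hy
  have := Nat.le_findGreatest (hbound _ hnext) hnext
  omega

theorem hasGoodPerfectSet (hcard : 2 ≤ Fintype.card V) (hstar : ∀ F ∈ 𝒞, IsStar F)
    (hconn : ∀ u v, Relation.ReflTransGen (Arc 𝒞) u v) : HasGoodPerfectSet 𝒞 := by
  classical
  by_contra hno
  have : Nontrivial V := Fintype.one_lt_card_iff_nontrivial.1 hcard
  obtain ⟨k, p, hinj, harc, hmax⟩ := exists_maximal_path (𝒞 := 𝒞)
  obtain ⟨w, hw⟩ := exists_ne (p k)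
  obtain ⟨s, t, hs, -, hst⟩ := exists_arc_leaving hconn (P := fun x => x = p k) rfl hw
  subst hs
  have hex : ∃ i, i ≤ k ∧ Arc 𝒞 (p k) (p i) := by
    obtain ⟨i, hi, rfl⟩ := hmax t hst
    exact ⟨i, hi, hst⟩
  obtain ⟨hik, harci⟩ := Nat.find_spec hex
  have hmin : ∀ j, j ≤ k → Arc 𝒞 (p k) (p j) → Nat.find hex ≤ j :=
    fun j h₁ h₂ => Nat.find_min' hex ⟨h₁, h₂⟩
  generalize Nat.find hex = i at hik harci hmin
  have hpk : ∀ j, Arc 𝒞 (p k) (p j) → j ≠ k := by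
    rintro j h rfl
    exact h.ne hstar rfl
  have hlt : i < k := lt_of_le_of_ne hik (hpk i harci)
  have hrange : ∀ y, Arc 𝒞 (p k) y → ∃ j, i ≤ j ∧ j < k ∧ p j = y := by
    intro y hy
    obtain ⟨j, hj, rfl⟩ := hmax y hy
    exact ⟨j, hmin j hj hy, lt_of_le_of_ne hj (hpk j hy), rfl⟩
  by_cases h₁ : k = i + 1
  · refine hno (hasGoodPerfectSet_of_unique_out hstar hconn harci ?_)
    intro y hy
    obtain ⟨j, hij, hjk, rfl⟩ := hrange y hy
    rw [show j = i by omega]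
  by_cases h₂ : k = i + 2
  · have hout : ∀ y, Arc 𝒞 (p k) y → y = p i ∨ y = p (i + 1) := by
      intro y hy
      obtain ⟨j, hij, hjk, rfl⟩ := hrange y hy
      rcases (show j = i ∨ j = i + 1 by omega) with rfl | rfl <;> simp
    by_cases hb : Arc 𝒞 (p k) (p (i + 1))
    · refine hno (hasGoodPerfectSet_of_triangle hstar hconn hout harci hb (harc i hlt) ?_)
      have := harc (i + 1) (by omega)
      rwa [show i + 1 + 1 = k by omega] at this
    · refine hno (hasGoodPerfectSet_of_unique_out hstar hconn harci ?_)
      intro y hy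
      rcases hout y hy with e | e
      · exact e
      · exact absurd (e ▸ hy) hb
  obtain ⟨B, T, htree, -, hT⟩ := InTree.of_path hinj harc i hik
  obtain ⟨F, hF, hkF⟩ := harci
  obtain ⟨Q, hQ, hperf, hk, hcl⟩ := htree.exists_perfectSet hstar hconn hF hkF
  have hmem : ∀ j, i ≤ j → j ≤ k → p j ∈ srcSet Q := by
    intro j hij
    induction j, hij using Nat.le_induction with
    | base => exact fun _ => hcl F (by simp) _ _ hkF hk
    | succ j hij ih =>
      intro hj
      exact hT _ (hcl.mono (Finset.subset_insert _ _)) j hij hj (ih (by omega))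
  have hne : ∀ m n, m ≤ k → n ≤ k → m ≠ n → p m ≠ p n :=
    fun m n hm hn hmn e => hmn (hinj m hm n hn e)
  have hN : ∀ y, Arc 𝒞 (p k) y → y ∈ srcSet Q := by
    intro y hy
    obtain ⟨j, hij, hjk, rfl⟩ := hrange y hy
    exact hmem j hij hjk.le
  rcases mem_of_not_hasGoodPerfectSet hstar hno hQ hperf hN hk (hmem i le_rfl hik)
    (hmem (i + 1) (by omega) hlt) (hne _ _ le_rfl hik (by omega))
    (hne _ _ le_rfl hlt (by omega)) (hne _ _ hik hlt (by omega))
    (hmem (i + 2) (by omega) (by omega)) with e | e | e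
  · exact hne _ _ (by omega) le_rfl (by omega) e
  · exact hne _ _ (by omega) hik (by omega) e
  · exact hne _ _ (by omega) hlt (by omega) e

end StarConnectivity

theorem stmt7 {V : Type*} [Fintype V] [DecidableEq V]
    (E : Finset (V × V)) (𝒞 : Finset (Finset (V × V)))
    (hcard : 2 ≤ Fintype.card V)
    (hdig : IsDigraph E) (hconn : SConn E)
    (hstar : ∀ F ∈ 𝒞, IsStar F) (hcover : 𝒞.biUnion id = E) :
    ∃ Q ⊆ 𝒞, PerfectSet Q ∧
      ((4 ≤ Q.card ∧ ∃ S : Finset V, InternalCut 𝒞 Q S) ∨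
       (∃ S₁ S₂ : Finset V, S₁ ≠ S₂ ∧ InternalCut 𝒞 Q S₁ ∧ InternalCut 𝒞 Q S₂ ∧
          cutStars 𝒞 S₁ ∩ cutStars 𝒞 S₂ = ∅)) := by
  refine hasGoodPerfectSet hcard hstar fun u v => Relation.ReflTransGen.mono ?_ _ _ (hconn u v)
  intro x y hxy
  rw [← hcover] at hxy
  obtain ⟨F, hF, hxyF⟩ := Finset.mem_biUnion.1 hxy
  exact ⟨F, hF, hxyF⟩
end

section
/- Let (G = (V, E), 𝒞) be an instance of Star Strong Connectivity whose input digraph G is bidirected (uv ∈ E implies vu ∈ E) and with |V| ≥ 2. Then there exists a feasible set R ⊆ 𝒞 such that for every function x : 𝒞 → ℝ with x_F ≥ 0 for all F ∈ 𝒞 and Σ_{F∈∂𝒞(S)} x_F ≥ 1 for every cut ∅ ⊂ S ⊂ V, one has |R| ≤ (3/2)·Σ_{F∈𝒞} x_F. In particular, the integrality gap of the cut-based linear program for Dual Power Assignment is at most 3/2. -/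
section ListPaths

variable {N : Type*} {r : N → N → Prop}

/-- A repetition-free `r`-chain of maximum length. -/
def IsLongestPath (r : N → N → Prop) (l : List N) : Prop :=
  l.Nodup ∧ l.IsChain r ∧ ∀ l' : List N, l'.Nodup → l'.IsChain r → l'.length ≤ l.length

lemma exists_isLongestPath [Fintype N] (r : N → N → Prop) : ∃ l, IsLongestPath r l := by
  obtain ⟨l, ⟨hn, hc⟩, hmin⟩ := (measure fun l : List N => Fintype.card N - l.length).wf.has_min
    {l : List N | l.Nodup ∧ l.IsChain r} ⟨[], List.nodup_nil, List.IsChain.nil⟩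
  refine ⟨l, hn, hc, fun l' hn' hc' => ?_⟩
  have h : ¬ (Fintype.card N - l'.length < Fintype.card N - l.length) := hmin l' ⟨hn', hc'⟩
  have := hn'.length_le_card
  omega

lemma IsLongestPath.mem_of_rel (hr : ∀ a b, r a b → r b a) {s x : N} {l : List N}
    (h : IsLongestPath r (s :: l)) (hx : r s x) : x ∈ s :: l := by
  by_contra hmem
  have := h.2.2 (x :: s :: l) (List.nodup_cons.2 ⟨hmem, h.1⟩)
    (List.isChain_cons_cons.2 ⟨hr _ _ hx, h.2.1⟩)
  simp at this

lemma isChain_reverse_append (hr : ∀ a b, r a b → r b a) {s u : N} {A B : List N}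
    (h : ((s :: A) ++ u :: B).IsChain r) (hu : r s u) :
    ((s :: A).reverse ++ u :: B).IsChain r := by
  rw [List.isChain_append] at h ⊢
  refine ⟨?_, h.2.1, ?_⟩
  · rw [List.isChain_reverse]
    exact h.1.imp fun a b hab => hr _ _ hab
  · simpa using hu

lemma nodup_reverse_append {A B : List N} (h : (A ++ B).Nodup) : (A.reverse ++ B).Nodup :=
  ((List.reverse_perm A).append_right B).nodup_iff.2 h

lemma IsLongestPath.rotate (hr : ∀ a b, r a b → r b a) {s u : N} {A B : List N}
    (h : IsLongestPath r ((s :: A) ++ u :: B)) (hu : r s u) :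
    IsLongestPath r ((s :: A).reverse ++ u :: B) := by
  refine ⟨nodup_reverse_append h.1, isChain_reverse_append hr h.2.1 hu, fun l' h1 h2 => ?_⟩
  have := h.2.2 l' h1 h2
  simp at this ⊢
  omega

lemma IsLongestPath.replace_head {s x p : N} {l : List N}
    (h : IsLongestPath r (s :: p :: l)) (hx : r x p) (hmem : x ∉ p :: l) :
    IsLongestPath r (x :: p :: l) :=
  ⟨List.nodup_cons.2 ⟨hmem, h.1.of_cons⟩,
    List.isChain_cons_cons.2 ⟨hx, (List.isChain_cons_cons.1 h.2.1).2⟩, by simpa using h.2.2⟩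

/-- A list splits at the last element satisfying a given predicate. -/
lemma exists_split_last (P : N → Prop) (l : List N) (h : ∃ x ∈ l, P x) :
    ∃ A b B, l = A ++ b :: B ∧ P b ∧ ∀ x ∈ B, ¬ P x := by
  induction l with
  | nil => simp at h
  | cons a l ih =>
    by_cases hl : ∃ x ∈ l, P x
    · obtain ⟨A, b, B, rfl, hb, hB⟩ := ih hl
      exact ⟨a :: A, b, B, rfl, hb, hB⟩
    · push Not at hl
      obtain ⟨x, hx, hP⟩ := h
      rcases List.mem_cons.1 hx with rfl | hx
      · exact ⟨[], x, l, rfl, hP, hl⟩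
      · exact absurd hP (hl x hx)

end ListPaths

section Stars

variable {σ N : Type*} {src : σ → N} {snk : σ → Set N} {Φ Q Q' : Finset σ}

/-- There is a star of `Φ` with source `a` having `b` among its sinks. -/
def StarArc (src : σ → N) (snk : σ → Set N) (Φ : Finset σ) (a b : N) : Prop :=
  ∃ F ∈ Φ, src F = a ∧ b ∈ snk F

/-- Reachability along the arcs of the stars in `Φ`. -/
def StarReach (src : σ → N) (snk : σ → Set N) (Φ : Finset σ) : N → N → Prop :=
  Relation.ReflTransGen (StarArc src snk Φ)

open Classical in
/-- The stars of `Φ` with source in `S` and some sink outside `S`. -/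
noncomputable def starCut (src : σ → N) (snk : σ → Set N) (Φ : Finset σ) (S : Set N) : Finset σ :=
  Φ.filter fun F => src F ∈ S ∧ ¬ snk F ⊆ S

lemma StarReach.mono (h : Q ⊆ Q') {a b : N} (hab : StarReach src snk Q a b) :
    StarReach src snk Q' a b :=
  Relation.ReflTransGen.mono (fun _ _ ⟨F, hF, hs⟩ => ⟨F, h hF, hs⟩) _ _ hab

lemma StarReach.of_mem {F : σ} (hF : F ∈ Q) {a b : N} (ha : src F = a) (hb : b ∈ snk F) :
    StarReach src snk Q a b :=
  Relation.ReflTransGen.single ⟨F, hF, ha, hb⟩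

lemma StarReach.trans {a b c : N} (hab : StarReach src snk Q a b)
    (hbc : StarReach src snk Q b c) : StarReach src snk Q a c :=
  Relation.ReflTransGen.trans hab hbc

open Classical in
/-- A chain of `k + 1` vertices is traversed by `k` stars. -/
lemma exists_stars_of_isChain (L : List N) (a : N) (h : (a :: L).IsChain (StarArc src snk Φ)) :
    ∃ Q ⊆ Φ, Q.card ≤ L.length ∧ ∀ x ∈ a :: L, StarReach src snk Q a x ∧
      ∀ b ∈ (a :: L).getLast?, StarReach src snk Q x b := by
  induction L generalizing a with
  | nil =>
    refine ⟨∅, by simp, by simp, ?_⟩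
    simp only [List.mem_singleton]
    rintro x rfl
    refine ⟨Relation.ReflTransGen.refl, ?_⟩
    simp only [List.getLast?_singleton, Option.mem_some_iff]
    rintro b rfl
    exact Relation.ReflTransGen.refl
  | cons c L ih =>
    rw [List.isChain_cons_cons] at h
    obtain ⟨⟨F, hF, hs, ht⟩, h2⟩ := h
    obtain ⟨Q, hQ, hcard, hreach⟩ := ih c h2
    have hac : StarReach src snk (insert F Q) a c :=
      StarReach.of_mem (Finset.mem_insert_self _ _) hs ht
    have hsub : Q ⊆ insert F Q := Finset.subset_insert _ _
    refine ⟨insert F Q, Finset.insert_subset hF hQ, ?_, ?_⟩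
    · simpa using (Finset.card_insert_le F Q).trans (by omega)
    · intro x hx
      rw [List.getLast?_cons_cons]
      rcases List.mem_cons.1 hx with rfl | hx
      · exact ⟨Relation.ReflTransGen.refl, fun b hb =>
          hac.trans (((hreach c (by simp)).2 b hb).mono hsub)⟩
      · exact ⟨hac.trans ((hreach x hx).1.mono hsub), fun b hb => ((hreach x hx).2 b hb).mono hsub⟩

open Classical in
/-- The vertices of a cycle of length `k` are strongly connected by `k` stars. -/
lemma exists_stars_of_cycle (L : List N) (a b : N) (h : (a :: L).IsChain (StarArc src snk Φ))
    (hb : b ∈ (a :: L).getLast?) (hba : StarArc src snk Φ b a) :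
    ∃ Q ⊆ Φ, Q.card ≤ (a :: L).length ∧ ∀ x ∈ a :: L, ∀ y ∈ a :: L, StarReach src snk Q x y := by
  obtain ⟨Q, hQ, hcard, hreach⟩ := exists_stars_of_isChain L a h
  obtain ⟨F, hF, hs, ht⟩ := hba
  have hsub : Q ⊆ insert F Q := Finset.subset_insert _ _
  refine ⟨insert F Q, Finset.insert_subset hF hQ, ?_, fun x hx y hy => ?_⟩
  · simpa using (Finset.card_insert_le F Q).trans (by omega)
  · exact (((hreach x hx).2 b hb).mono hsub).trans
      ((StarReach.of_mem (Finset.mem_insert_self _ _) hs ht).trans ((hreach y hy).1.mono hsub))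

/-- `W` has at least two vertices, is strongly connected by at most `|W|` stars, and there are two
cuts crossed by disjoint sets of stars, all of which lie inside `W`. -/
def IsPerfectSet (src : σ → N) (snk : σ → Set N) (Φ : Finset σ) (W : Finset N) : Prop :=
  2 ≤ W.card ∧ (∃ Q ⊆ Φ, Q.card ≤ W.card ∧ ∀ a ∈ W, ∀ b ∈ W, StarReach src snk Q a b) ∧
    ∃ S T : Set N, S.Nonempty ∧ S ≠ Set.univ ∧ T.Nonempty ∧ T ≠ Set.univ ∧
      Disjoint (starCut src snk Φ S) (starCut src snk Φ T) ∧
      (∀ F ∈ starCut src snk Φ S, src F ∈ W ∧ snk F ⊆ W) ∧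
      ∀ F ∈ starCut src snk Φ T, src F ∈ W ∧ snk F ⊆ W

lemma mem_starCut {S : Set N} {F : σ} :
    F ∈ starCut src snk Φ S ↔ F ∈ Φ ∧ src F ∈ S ∧ ¬ snk F ⊆ S := by
  simp [starCut]

lemma singleton_ne_univ_of_ne {s t : N} (h : s ≠ t) : ({s} : Set N) ≠ Set.univ := fun he =>
  h (by have : t ∈ ({s} : Set N) := he ▸ Set.mem_univ t
        simpa using this.symm)

/-- Two distinct vertices whose neighbourhoods lie in `W` provide the cuts of a perfect set. -/
lemma IsPerfectSet.of_pair {W : Finset N} (hQ : ∃ Q ⊆ Φ, Q.card ≤ W.card ∧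
      ∀ a ∈ W, ∀ b ∈ W, StarReach src snk Q a b) {s t : N} (hst : s ≠ t) (hs : s ∈ W) (ht : t ∈ W)
    (hsW : ∀ x, StarArc src snk Φ s x → x ∈ W) (htW : ∀ x, StarArc src snk Φ t x → x ∈ W) :
    IsPerfectSet src snk Φ W := by
  have key : ∀ v ∈ W, (∀ x, StarArc src snk Φ v x → x ∈ W) →
      ∀ F ∈ starCut src snk Φ {v}, src F ∈ W ∧ snk F ⊆ W := by
    intro v hv hvW F hF
    rw [mem_starCut] at hF
    obtain ⟨hF, hsrc, -⟩ := hF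
    rw [Set.mem_singleton_iff] at hsrc
    exact ⟨hsrc ▸ hv, fun x hx => hvW x ⟨F, hF, hsrc, hx⟩⟩
  refine ⟨Finset.one_lt_card.2 ⟨s, hs, t, ht, hst⟩, hQ, {s}, {t}, Set.singleton_nonempty _,
    singleton_ne_univ_of_ne hst, Set.singleton_nonempty _, singleton_ne_univ_of_ne hst.symm, ?_,
    key s hs hsW, key t ht htW⟩
  rw [Finset.disjoint_left]
  intro F hF hF'
  rw [mem_starCut] at hF hF'
  exact hst (hF.2.1.symm.trans hF'.2.1)

open Classical in
/-- If the end of a longest path has a neighbour other than itself and its predecessor, then the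
path and its rotation yield two closed vertices in a common cycle. -/
lemma exists_isPerfectSet_of_rotation
    (hsym : ∀ a b, StarArc src snk Φ a b → StarArc src snk Φ b a)
    {s u : N} {A B : List N} (hA : A ≠ [])
    (h : IsLongestPath (StarArc src snk Φ) ((s :: A) ++ u :: B)) (hu : StarArc src snk Φ s u) :
    ∃ W, IsPerfectSet src snk Φ W := by
  obtain ⟨A', s', rfl⟩ : ∃ A' s', A = A' ++ [s'] := ⟨_, _, (List.dropLast_append_getLast hA).symm⟩
  have hrot := h.rotate hsym hu
  obtain ⟨C, b, D, hCD, hb, hD⟩ := exists_split_last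
    (fun x => StarArc src snk Φ s x ∨ StarArc src snk Φ s' x) (u :: B) ⟨u, by simp, Or.inl hu⟩
  rw [hCD] at h hrot
  have hrev : (s :: (A' ++ [s'])).reverse = s' :: (A'.reverse ++ [s]) := by simp
  rw [hrev] at hrot
  have hsplit : (s :: (A' ++ [s'])) ++ (C ++ b :: D) =
      (s :: (A' ++ [s']) ++ C ++ [b]) ++ D := by simp
  have hsplit' : s' :: (A'.reverse ++ [s]) ++ (C ++ b :: D) =
      (s' :: (A'.reverse ++ [s]) ++ C ++ [b]) ++ D := by simp
  have hmem : ∀ x, StarArc src snk Φ s x → x ∈ s :: (A' ++ [s']) ++ C ++ [b] := by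
    intro x hx
    have h1 : x ∈ s :: (A' ++ [s']) ++ (C ++ b :: D) := h.mem_of_rel hsym hx
    rw [hsplit, List.mem_append] at h1
    exact h1.resolve_right fun hxD => hD x hxD (Or.inl hx)
  have hmem' : ∀ x, StarArc src snk Φ s' x → x ∈ s :: (A' ++ [s']) ++ C ++ [b] := by
    intro x hx
    have h1 : x ∈ s' :: (A'.reverse ++ [s]) ++ (C ++ b :: D) := hrot.mem_of_rel hsym hx
    rw [hsplit', List.mem_append] at h1
    have h2 := h1.resolve_right fun hxD => hD x hxD (Or.inr hx)
    simp only [List.mem_append, List.mem_cons, List.mem_reverse] at h2 ⊢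
    tauto
  rw [hsplit] at h
  rw [hsplit'] at hrot
  have hn : (s :: (A' ++ [s']) ++ C ++ [b]).Nodup := h.1.of_append_left
  refine ⟨(s :: (A' ++ [s']) ++ C ++ [b]).toFinset, IsPerfectSet.of_pair (s := s) (t := s')
    ?_ ?_ (by simp) (by simp) (fun x hx => List.mem_toFinset.2 (hmem x hx))
    fun x hx => List.mem_toFinset.2 (hmem' x hx)⟩
  · rw [List.toFinset_card_of_nodup hn]
    simp only [List.mem_toFinset]
    rcases hb with hb | hb
    · exact exists_stars_of_cycle (A' ++ [s'] ++ C ++ [b]) s b (List.isChain_append.1 h.2.1).1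
        (by rw [← List.cons_append, List.getLast?_concat]; rfl) (hsym _ _ hb)
    · obtain ⟨Q, hQ, hcard, hreach⟩ := exists_stars_of_cycle (A'.reverse ++ [s] ++ C ++ [b]) s' b
        (List.isChain_append.1 hrot.2.1).1
        (by rw [← List.cons_append, List.getLast?_concat]; rfl) (hsym _ _ hb)
      refine ⟨Q, hQ, by simpa using hcard, fun x hx y hy => hreach x ?_ y ?_⟩
      · simp only [List.mem_append, List.mem_cons, List.mem_reverse] at hx ⊢
        tauto
      · simp only [List.mem_append, List.mem_cons, List.mem_reverse] at hy ⊢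
        tauto
  · rintro rfl
    simp at hn

open Classical in
/-- If every end of a longest path is only adjacent to its predecessor, then the end and its
predecessor extend to a perfect set. -/
lemma exists_isPerfectSet_of_leaf
    (hsym : ∀ a b, StarArc src snk Φ a b → StarArc src snk Φ b a)
    {s p : N} {l : List N} (h : IsLongestPath (StarArc src snk Φ) (s :: p :: l))
    (hleaf : ∀ x, IsLongestPath (StarArc src snk Φ) (x :: p :: l) →
      ∀ y, StarArc src snk Φ x y → y = x ∨ y = p) :
    ∃ W, IsPerfectSet src snk Φ W := by
  have hsp : StarArc src snk Φ s p := (List.isChain_cons_cons.1 h.2.1).1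
  have hs_ne : s ≠ p := by
    rintro rfl
    simpa using h.1
  by_cases hx : ∃ F ∈ Φ, src F = p ∧ s ∈ snk F ∧ ∃ x ∈ snk F, x ∉ s :: p :: l
  · obtain ⟨F, hF, hFp, hFs, x, hFx, hxl⟩ := hx
    simp only [List.mem_cons, not_or] at hxl
    have hxp : StarArc src snk Φ x p := hsym _ _ ⟨F, hF, hFp, hFx⟩
    have hlx := h.replace_head hxp (by simp [hxl.2.1, hxl.2.2])
    obtain ⟨F₁, hF₁, hF₁s, hF₁p⟩ := hsp
    obtain ⟨F₂, hF₂, hF₂x, hF₂p⟩ := hxp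
    refine ⟨{p, s, x}, IsPerfectSet.of_pair ⟨{F, F₁, F₂}, ?_, ?_, ?_⟩ (s := s) (t := x)
      (Ne.symm hxl.1) (by simp) (by simp) (fun y hy => ?_) (fun y hy => ?_)⟩
    · intro G hG
      simp only [Finset.mem_insert, Finset.mem_singleton] at hG
      rcases hG with rfl | rfl | rfl <;> assumption
    · rw [Finset.card_eq_three.2 ⟨p, s, x, hs_ne.symm, Ne.symm hxl.2.1, Ne.symm hxl.1, rfl⟩]
      exact Finset.card_le_three
    · have h1 : ∀ a ∈ ({p, s, x} : Finset N), StarReach src snk {F, F₁, F₂} a p ∧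
          StarReach src snk {F, F₁, F₂} p a := by
        intro a ha
        simp only [Finset.mem_insert, Finset.mem_singleton] at ha
        rcases ha with rfl | rfl | rfl
        · exact ⟨Relation.ReflTransGen.refl, Relation.ReflTransGen.refl⟩
        · exact ⟨.of_mem (F := F₁) (by simp) hF₁s hF₁p, .of_mem (F := F) (by simp) hFp hFs⟩
        · exact ⟨.of_mem (F := F₂) (by simp) hF₂x hF₂p, .of_mem (F := F) (by simp) hFp hFx⟩
      exact fun a ha b hb => (h1 a ha).1.trans (h1 b hb).2
    · rcases hleaf s h y hy with rfl | rfl <;> simp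
    · rcases hleaf x hlx y hy with rfl | rfl <;> simp
  · push Not at hx
    obtain ⟨A, b, B, hAB, hb, hB⟩ := exists_split_last
      (fun x => x = p ∨ ∃ F ∈ Φ, src F = p ∧ s ∈ snk F ∧ x ∈ snk F) (p :: l)
      ⟨p, by simp, Or.inl rfl⟩
    obtain ⟨F, hF, hFp, hFs, hFb⟩ : ∃ F ∈ Φ, src F = p ∧ s ∈ snk F ∧ (b = p ∨ b ∈ snk F) := by
      rcases hb with rfl | ⟨F, hF, h1, h2, h3⟩
      · obtain ⟨F, hF, h1, h2⟩ := hsym _ _ hsp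
        exact ⟨F, hF, h1, h2, Or.inl rfl⟩
      · exact ⟨F, hF, h1, h2, Or.inr h3⟩
    have hsplit : p :: l = (A ++ [b]) ++ B := by simp [hAB]
    have hp_mem : p ∈ A ++ [b] := by
      have : p ∈ (A ++ [b]) ++ B := hsplit ▸ List.mem_cons_self
      exact (List.mem_append.1 this).resolve_right fun hpB => hB p hpB (Or.inl rfl)
    have hn : (s :: (A ++ [b])).Nodup := by
      have := h.1
      rw [hsplit, ← List.cons_append] at this
      exact this.of_append_left
    have hchain : (A ++ [b]).IsChain (StarArc src snk Φ) := by
      have := (List.isChain_cons_cons.1 h.2.1).2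
      rw [hsplit] at this
      exact (List.isChain_append.1 this).1
    have hhead : p ∈ (A ++ [b]).head? := by
      cases A <;> simp_all
    obtain ⟨Q, hQ, hcard, hreach⟩ := exists_stars_of_isChain A.reverse b (Φ := Φ) (src := src)
      (snk := snk) (by
        have : (A ++ [b]).reverse.IsChain (StarArc src snk Φ) :=
          List.isChain_reverse.2 (hchain.imp fun a b hab => hsym _ _ hab)
        simpa using this)
    have hrev : b :: A.reverse = (A ++ [b]).reverse := by simp
    rw [hrev] at hreach
    simp only [List.mem_reverse, List.getLast?_reverse] at hreach
    obtain ⟨F₁, hF₁, hF₁s, hF₁p⟩ := hsp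
    have hsub : Q ⊆ insert F (insert F₁ Q) :=
      (Finset.subset_insert _ _).trans (Finset.subset_insert _ _)
    have hin : ∀ G ∈ starCut src snk Φ {s}ᶜ, src G = p ∧ s ∈ snk G := by
      intro G hG
      rw [mem_starCut] at hG
      obtain ⟨hG, hGs, hsnk⟩ := hG
      have hsG : s ∈ snk G := by
        by_contra hns
        exact hsnk fun y hy => by
          rintro rfl
          exact hns hy
      exact ⟨(hleaf s h _ (hsym _ _ ⟨G, hG, rfl, hsG⟩)).resolve_left hGs, hsG⟩
    refine ⟨(s :: (A ++ [b])).toFinset, ?_, ⟨insert F (insert F₁ Q), ?_, ?_, ?_⟩, {s}, {s}ᶜ,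
      Set.singleton_nonempty _, singleton_ne_univ_of_ne hs_ne, ⟨p, hs_ne.symm⟩, ?_, ?_, ?_, ?_⟩
    · rw [List.toFinset_card_of_nodup hn]
      simp
    · exact Finset.insert_subset hF (Finset.insert_subset hF₁ hQ)
    · rw [List.toFinset_card_of_nodup hn]
      have h1 := Finset.card_insert_le F (insert F₁ Q)
      have h2 := Finset.card_insert_le F₁ Q
      simp only [List.length_reverse] at hcard
      simp only [List.length_cons, List.length_append, List.length_nil]
      omega
    · have hps : StarReach src snk (insert F (insert F₁ Q)) p s := .of_mem (F := F) (by simp) hFp hFs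
      have hsp : StarReach src snk (insert F (insert F₁ Q)) s p :=
        .of_mem (F := F₁) (by simp) hF₁s hF₁p
      have hpb : StarReach src snk (insert F (insert F₁ Q)) p b := by
        rcases hFb with rfl | hFb
        · exact Relation.ReflTransGen.refl
        · exact .of_mem (F := F) (by simp) hFp hFb
      have h1 : ∀ a ∈ (s :: (A ++ [b])).toFinset,
          StarReach src snk (insert F (insert F₁ Q)) a p ∧
          StarReach src snk (insert F (insert F₁ Q)) p a := by
        intro a ha
        rcases List.mem_cons.1 (List.mem_toFinset.1 ha) with rfl | ha
        · exact ⟨hsp, hps⟩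
        · exact ⟨((hreach a ha).2 p hhead).mono hsub, hpb.trans ((hreach a ha).1.mono hsub)⟩
      exact fun a ha b hb => (h1 a ha).1.trans (h1 b hb).2
    · intro he
      have : s ∈ ({s}ᶜ : Set N) := he ▸ Set.mem_univ s
      simp at this
    · rw [Finset.disjoint_left]
      intro G hG hG'
      rw [mem_starCut] at hG hG'
      exact hG'.2.1 hG.2.1
    · intro G hG
      rw [mem_starCut] at hG
      obtain ⟨hG, hGs, -⟩ := hG
      rw [Set.mem_singleton_iff] at hGs
      refine ⟨by simp [hGs], fun y hy => ?_⟩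
      rw [Finset.mem_coe, List.mem_toFinset, List.mem_cons]
      rcases hleaf s h y ⟨G, hG, hGs, hy⟩ with rfl | rfl
      · exact Or.inl rfl
      · exact Or.inr hp_mem
    · intro G hG
      obtain ⟨hGp, hGs⟩ := hin G hG
      have hGΦ := (mem_starCut.1 hG).1
      refine ⟨by rw [hGp, List.mem_toFinset]; exact List.mem_cons_of_mem _ hp_mem, fun y hy => ?_⟩
      rw [Finset.mem_coe, List.mem_toFinset, List.mem_cons]
      have hyl := hx G hGΦ hGp hGs y hy
      rcases List.mem_cons.1 hyl with rfl | hyl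
      · exact Or.inl rfl
      · rw [hsplit, List.mem_append] at hyl
        exact Or.inr (hyl.resolve_right fun hyB => hB y hyB (Or.inr ⟨G, hGΦ, hGp, hGs, hy⟩))

lemma exists_isPerfectSet [Fintype N] [Nontrivial N]
    (hsym : ∀ a b, StarArc src snk Φ a b → StarArc src snk Φ b a)
    (hconn : ∀ a b, StarReach src snk Φ a b) : ∃ W, IsPerfectSet src snk Φ W := by
  obtain ⟨l, hl⟩ := exists_isLongestPath (StarArc src snk Φ)
  have hlen : 2 ≤ l.length := by
    obtain ⟨a, b, hab⟩ := exists_pair_ne N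
    obtain ⟨c, d, hcd, hne⟩ : ∃ c d, StarArc src snk Φ c d ∧ c ≠ d := by
      by_contra! hcon
      have hconst : ∀ y, StarReach src snk Φ a y → a = y := by
        intro y hy
        induction hy with
        | refl => rfl
        | tail _ h ih => exact ih.trans (hcon _ _ h)
      exact hab (hconst b (hconn a b))
    simpa using hl.2.2 [c, d] (by simpa using hne) (by simpa using hcd)
  by_cases hrot : ∃ s p l', IsLongestPath (StarArc src snk Φ) (s :: p :: l') ∧
      ∃ u, StarArc src snk Φ s u ∧ u ≠ s ∧ u ≠ p
  · obtain ⟨s, p, l', h, u, hu, hus, hup⟩ := hrot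
    have hmem : u ∈ l' := by simpa [hus, hup] using h.mem_of_rel hsym hu
    obtain ⟨A, B, rfl⟩ := List.append_of_mem hmem
    exact exists_isPerfectSet_of_rotation hsym (A := p :: A) (by simp) h hu
  · push Not at hrot
    match l, hl, hlen with
    | s :: p :: l, hl, _ =>
      refine exists_isPerfectSet_of_leaf hsym hl fun x hx y hy => ?_
      by_cases hyx : y = x
      · exact Or.inl hyx
      · exact Or.inr (hrot x p l hx y hy hyx)

end Stars

section Contraction

variable {σ : Type*}

open Classical in
/-- Repeated contraction of perfect sets: the stars used beyond a spanning tree are paid for by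
pairs of cuts that no star crosses twice. -/
theorem exists_stars_card_le (n : ℕ) : ∀ {N : Type*} [Fintype N] [Nonempty N] (src : σ → N)
    (snk : σ → Set N) (Φ : Finset σ), Fintype.card N = n →
    (∀ a b, StarArc src snk Φ a b → StarArc src snk Φ b a) →
    (∀ a b, StarReach src snk Φ a b) →
    ∃ R ⊆ Φ, ∃ t : ℕ, R.card + 1 ≤ n + t ∧ (∀ a b, StarReach src snk R a b) ∧
      ∀ x : σ → ℝ, (∀ F ∈ Φ, 0 ≤ x F) →
        (∀ S : Set N, S.Nonempty → S ≠ Set.univ → 1 ≤ ∑ F ∈ starCut src snk Φ S, x F) →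
        2 * (t : ℝ) ≤ ∑ F ∈ Φ with ¬ snk F ⊆ {src F}, x F := by
  induction n using Nat.strong_induction_on with
  | _ n ih =>
  intro N _ _ src snk Φ hn hsym hconn
  rcases subsingleton_or_nontrivial N with hsub | hnt
  · refine ⟨∅, by simp, 0, ?_, fun a b => ?_, fun x hx _ => ?_⟩
    · have := Fintype.card_pos (α := N)
      simp
      omega
    · rw [Subsingleton.elim a b]
      exact Relation.ReflTransGen.refl
    · simpa using Finset.sum_nonneg fun F hF => hx F (Finset.mem_filter.1 hF).1
  obtain ⟨W, hW2, ⟨Q, hQ, hQcard, hQreach⟩, S, T, hS, hS', hT, hT', hdisj, hSW, hTW⟩ :=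
    exists_isPerfectSet hsym hconn
  obtain ⟨w, hw⟩ : W.Nonempty := Finset.card_pos.1 (by omega)
  let N' := {v : N // v ∈ insert w Wᶜ}
  let q : N → N' := fun v => if hv : v ∈ W then ⟨w, by simp⟩ else ⟨v, by simp [hv]⟩
  have hqW : ∀ v ∈ W, q v = ⟨w, by simp⟩ := fun v hv => by simp [q, hv]
  have hval : ∀ v, (q v).1 = if v ∈ W then w else v := fun v => by
    by_cases hv : v ∈ W <;> simp [q, hv]
  have hq : ∀ a b, q a = q b → a = b ∨ a ∈ W ∧ b ∈ W := by
    intro a b hab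
    have hab' := congrArg Subtype.val hab
    rw [hval, hval] at hab'
    by_cases ha : a ∈ W <;> by_cases hb : b ∈ W <;> simp only [ha, hb, if_true, if_false] at hab'
    · exact Or.inr ⟨ha, hb⟩
    · exact absurd (hab' ▸ hw) hb
    · exact absurd (hab' ▸ hw) ha
    · exact Or.inl hab'
  have hqsurj : ∀ v : N', q v.1 = v := by
    rintro ⟨v, hv⟩
    by_cases hvW : v ∈ W
    · have : v = w := by simpa [hvW] using hv
      subst this
      simp [q, hvW]
    · simp [q, hvW]
  have : Nonempty N' := ⟨⟨w, by simp⟩⟩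
  have hcard' : Fintype.card N' + W.card = n + 1 := by
    have h1 : Fintype.card N' = (insert w Wᶜ).card := Fintype.card_coe _
    have h2 : (insert w Wᶜ).card = Wᶜ.card + 1 := Finset.card_insert_of_notMem (by simpa using hw)
    have h3 := Finset.card_add_card_compl W
    omega
  have harc : ∀ a b, StarArc src snk Φ a b →
      StarArc (q ∘ src) (fun F => q '' snk F) Φ (q a) (q b) := by
    rintro a b ⟨F, hF, rfl, hb⟩
    exact ⟨F, hF, rfl, b, hb, rfl⟩
  obtain ⟨R, hR, t, hRcard, hRreach, hRx⟩ := ih (Fintype.card N') (by omega) (q ∘ src)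
    (fun F => q '' snk F) Φ rfl
    (by
      rintro _ _ ⟨F, hF, rfl, b, hb, rfl⟩
      exact harc _ _ (hsym _ _ ⟨F, hF, rfl, hb⟩))
    (by
      intro a b
      rw [← hqsurj a, ← hqsurj b]
      exact Relation.ReflTransGen.lift q harc _ _ (hconn a.1 b.1))
  have hfib : ∀ a b, q a = q b → StarReach src snk (R ∪ Q) a b := by
    intro a b hab
    rcases hq a b hab with rfl | ⟨ha, hb⟩
    · exact Relation.ReflTransGen.refl
    · exact (hQreach a ha b hb).mono Finset.subset_union_right
  refine ⟨R ∪ Q, Finset.union_subset hR hQ, t + 1, ?_, ?_, ?_⟩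
  · have := Finset.card_union_le R Q
    omega
  · intro a b
    have hlift : ∀ c : N', StarReach (q ∘ src) (fun F => q '' snk F) R (q a) c →
        ∀ d, q d = c → StarReach src snk (R ∪ Q) a d := by
      intro c hc
      induction hc with
      | refl => exact fun d hd => hfib a d hd.symm
      | tail _ h ih =>
        obtain ⟨F, hF, hFc, e, he, rfl⟩ := h
        intro d hd
        exact (ih (src F) hFc).trans ((StarReach.of_mem (Finset.mem_union_left _ hF) rfl he).trans
          (hfib e d hd.symm))
    exact hlift (q b) (hRreach _ _) b rfl
  · intro x hx hcut
    have hrest := hRx x hx (by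
      intro U hU hU'
      refine (hcut (q ⁻¹' U) ?_ ?_).trans (le_of_eq (Finset.sum_congr ?_ fun _ _ => rfl))
      · obtain ⟨v, hv⟩ := hU
        exact ⟨v.1, by simpa [hqsurj v] using hv⟩
      · intro he
        refine hU' (Set.eq_univ_of_forall fun v => ?_)
        have : v.1 ∈ q ⁻¹' U := he ▸ Set.mem_univ _
        simpa [hqsurj v] using this
      · ext F
        simp [mem_starCut, Set.image_subset_iff])
    have hlocal : ∀ U : Set N, (∀ F ∈ starCut src snk Φ U, src F ∈ W ∧ snk F ⊆ W) →
        ∀ F ∈ starCut src snk Φ U,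
          F ∈ Φ ∧ ¬ snk F ⊆ {src F} ∧ q '' snk F ⊆ {(q ∘ src) F} := by
      intro U hU F hF
      obtain ⟨h1, h2⟩ := hU F hF
      obtain ⟨hFΦ, h3, h4⟩ := mem_starCut.1 hF
      refine ⟨hFΦ, fun hsub => h4 (hsub.trans (by simpa using h3)), ?_⟩
      rintro _ ⟨y, hy, rfl⟩
      simp [hqW y (h2 hy), hqW _ h1]
    set P := Φ.filter fun F => ¬ q '' snk F ⊆ {(q ∘ src) F} with hP
    have hPS : Disjoint P (starCut src snk Φ S ∪ starCut src snk Φ T) := by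
      rw [Finset.disjoint_left]
      intro F hF hF'
      rcases Finset.mem_union.1 hF' with hF' | hF'
      · exact (Finset.mem_filter.1 hF).2 (hlocal S hSW F hF').2.2
      · exact (Finset.mem_filter.1 hF).2 (hlocal T hTW F hF').2.2
    have hsubset : P ∪ (starCut src snk Φ S ∪ starCut src snk Φ T) ⊆
        Φ.filter fun F => ¬ snk F ⊆ {src F} := by
      intro F hF
      rw [Finset.mem_filter]
      rcases Finset.mem_union.1 hF with hF | hF
      · obtain ⟨h1, h2⟩ := Finset.mem_filter.1 hF
        refine ⟨h1, fun hsub => h2 ?_⟩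
        rintro _ ⟨y, hy, rfl⟩
        rw [Set.mem_singleton_iff.1 (hsub hy)]
        rfl
      · rcases Finset.mem_union.1 hF with hF | hF
        · exact ⟨(hlocal S hSW F hF).1, (hlocal S hSW F hF).2.1⟩
        · exact ⟨(hlocal T hTW F hF).1, (hlocal T hTW F hF).2.1⟩
    have hmono := Finset.sum_le_sum_of_subset_of_nonneg hsubset
      (fun F hF _ => hx F (Finset.mem_filter.1 hF).1)
    rw [Finset.sum_union hPS, Finset.sum_union hdisj] at hmono
    have h1 := hcut S hS hS'
    have h2 := hcut T hT hT'
    push_cast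
    linarith

end Contraction

theorem stmt9 {V : Type*} [Fintype V] [DecidableEq V]
    (E : Finset (V × V)) (𝒞 : Finset (Finset (V × V)))
    (hcard : 2 ≤ Fintype.card V)
    (hdig : IsDigraph E) (hbi : ∀ a ∈ E, (a.2, a.1) ∈ E) (hconn : SConn E)
    (hstar : ∀ F ∈ 𝒞, IsStar F) (hcover : 𝒞.biUnion id = E) :
    ∃ R ⊆ 𝒞, SConn (R.biUnion id) ∧
      ∀ x : Finset (V × V) → ℝ, (∀ F ∈ 𝒞, 0 ≤ x F) →
        (∀ S : Finset V, S.Nonempty → S ≠ Finset.univ →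
          1 ≤ ∑ F ∈ cutStars 𝒞 S, x F) →
        (R.card : ℝ) ≤ (3 / 2) * ∑ F ∈ 𝒞, x F := by
  classical
  have : Nonempty V := Fintype.card_pos_iff.1 (by omega)
  have : Nontrivial V := Fintype.one_lt_card_iff_nontrivial.1 (by omega)
  let src : Finset (V × V) → V := fun F =>
    if h : F.Nonempty then h.choose.1 else Classical.arbitrary V
  let snk : Finset (V × V) → Set V := fun F => {v | ∃ a ∈ F, a.2 = v}
  have hsrc : ∀ F ∈ 𝒞, ∀ a ∈ F, a.1 = src F := by
    intro F hF a ha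
    have hne : F.Nonempty := ⟨a, ha⟩
    simp only [src, hne, dite_true]
    exact (hstar F hF).2.1 a ha _ hne.choose_spec
  have harc : ∀ R ⊆ 𝒞, ∀ u v, StarArc src snk R u v ↔ (u, v) ∈ R.biUnion id := by
    intro R hR u v
    rw [Finset.mem_biUnion]
    constructor
    · rintro ⟨F, hF, rfl, ⟨a, b⟩, ha, rfl⟩
      exact ⟨F, hF, by simpa [← hsrc F (hR hF) _ ha] using ha⟩
    · rintro ⟨F, hF, ha⟩
      exact ⟨F, hF, (hsrc F (hR hF) _ ha).symm, _, ha, rfl⟩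
  have hreach : ∀ R ⊆ 𝒞, ∀ u v, StarReach src snk R u v ↔ SReach (R.biUnion id) u v := by
    intro R hR u v
    have : StarArc src snk R = fun u v => (u, v) ∈ R.biUnion id := by
      ext u v
      exact harc R hR u v
    rw [StarReach, SReach, this]
  have hcut : ∀ S : Finset V, cutStars 𝒞 S = starCut src snk 𝒞 S := by
    intro S
    ext F
    rw [cutStars, Finset.mem_filter, mem_starCut]
    refine and_congr_right fun hF => and_congr ?_ ?_
    · constructor
      · rintro ⟨a, ha, haS⟩
        exact hsrc F hF a ha ▸ haS
      · intro h
        obtain ⟨a, ha⟩ := (hstar F hF).1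
        exact ⟨a, ha, (hsrc F hF a ha).symm ▸ h⟩
    · rw [Set.not_subset]
      exact ⟨fun ⟨a, ha, h⟩ => ⟨a.2, ⟨a, ha, rfl⟩, h⟩, fun ⟨_, ⟨a, ha, hav⟩, h⟩ =>
        ⟨a, ha, hav ▸ h⟩⟩
  obtain ⟨R, hR, t, hcardR, hRreach, hRx⟩ := exists_stars_card_le _ src snk 𝒞 rfl
    (by
      intro a b hab
      rw [harc 𝒞 subset_rfl, hcover] at hab ⊢
      exact hbi _ hab)
    (by
      intro a b
      rw [hreach 𝒞 subset_rfl, hcover]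
      exact hconn a b)
  refine ⟨R, hR, fun u v => (hreach R hR u v).1 (hRreach u v), fun x hx hxcut => ?_⟩
  have hxcut' : ∀ S : Set V, S.Nonempty → S ≠ Set.univ → 1 ≤ ∑ F ∈ starCut src snk 𝒞 S, x F := by
    intro S hS hS'
    have := hxcut S.toFinset (by simpa using hS) (by simpa using hS')
    rwa [hcut, Set.coe_toFinset] at this
  have ht : 2 * (t : ℝ) ≤ ∑ F ∈ 𝒞, x F := (hRx x hx hxcut').trans
    (Finset.sum_le_sum_of_subset_of_nonneg (Finset.filter_subset _ _) fun F hF _ => hx F hF)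
  have hn : (Fintype.card V : ℝ) ≤ ∑ F ∈ 𝒞, x F := by
    rw [← Finset.sum_fiberwise 𝒞 src x]
    calc (Fintype.card V : ℝ) = ∑ v : V, (1 : ℝ) := by simp
      _ ≤ _ := Finset.sum_le_sum fun v _ => ?_
    obtain ⟨u, hu⟩ := exists_ne v
    refine (hxcut' {v} (Set.singleton_nonempty v) (singleton_ne_univ_of_ne hu.symm)).trans
      (Finset.sum_le_sum_of_subset_of_nonneg (fun F hF => ?_)
        fun F hF _ => hx F (Finset.mem_filter.1 hF).1)
    obtain ⟨h1, h2, -⟩ := mem_starCut.1 hF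
    exact Finset.mem_filter.2 ⟨h1, h2⟩
  have hR' : (R.card : ℝ) + 1 ≤ Fintype.card V + t := by exact_mod_cast hcardR
  linarith
end
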